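/- arXiv:2112.09247 — 3 statements merged into one kernel-verified Lean document; each statement's English description precedes it below -/
import Mathlib

section
/- Let f : ℝ → ℝ be a continuous function for which there exist c with 0 < c ≤ ∞ and q ∈ (0,1) such that t ↦ f(t)/t^q is positive and non-increasing on (0, c). Let Ω ⊆ ℝⁿ be a bounded open set and let u, v : closure(Ω) → ℝ be continuous functions that are positive in Ω, with max{sup|u|, sup|v|} < c, such that u is a viscosity subsolution and v is a viscosity supersolution of min{|∇w| − f(w), −Δ_∞ w} = 0 in Ω. If u ≤ v on ∂Ω, then u ≤ v on closure(Ω). -/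
open Real Set Metric Filter Topology

/-- `⟨D²φ(x)∇φ(x), ∇φ(x)⟩`, i.e. `Δ_∞φ(x)`. -/
noncomputable def hessQ {n : ℕ} (φ : EuclideanSpace ℝ (Fin n) → ℝ)
    (x : EuclideanSpace ℝ (Fin n)) : ℝ :=
  iteratedFDeriv ℝ 2 φ x ![gradient φ x, gradient φ x]

/-- Viscosity supersolution of `min{|∇w| − f(w), −Δ_∞ w} = 0` in `Ω`. -/
def IsFSuper {n : ℕ} (Ω : Set (EuclideanSpace ℝ (Fin n))) (f : ℝ → ℝ)
    (w : EuclideanSpace ℝ (Fin n) → ℝ) : Prop :=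
  ∀ x₀ ∈ Ω, ∀ φ : EuclideanSpace ℝ (Fin n) → ℝ, ContDiff ℝ 2 φ →
    IsLocalMinOn (fun x => w x - φ x) Ω x₀ →
    (0 ≤ ‖gradient φ x₀‖ - f (w x₀) ∧ 0 ≤ -(hessQ φ x₀))

/-- Viscosity subsolution of `min{|∇w| − f(w), −Δ_∞ w} = 0` in `Ω`. -/
def IsFSub {n : ℕ} (Ω : Set (EuclideanSpace ℝ (Fin n))) (f : ℝ → ℝ)
    (w : EuclideanSpace ℝ (Fin n) → ℝ) : Prop :=
  ∀ x₀ ∈ Ω, ∀ φ : EuclideanSpace ℝ (Fin n) → ℝ, ContDiff ℝ 2 φ →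
    IsLocalMaxOn (fun x => w x - φ x) Ω x₀ →
    min (‖gradient φ x₀‖ - f (w x₀)) (-(hessQ φ x₀)) ≤ 0

section RadialCalculus

variable {n : ℕ}

lemma hasFDerivAt_comp_norm_sub_sq {G : ℝ → ℝ} {G' : ℝ} (x w : EuclideanSpace ℝ (Fin n))
    (hG : HasDerivAt G G' (‖w - x‖ ^ 2)) :
    HasFDerivAt (fun w => G (‖w - x‖ ^ 2)) ((2 * G') • innerSL ℝ (w - x)) w := by
  have h1 : HasFDerivAt (fun w : EuclideanSpace ℝ (Fin n) => ‖w - x‖ ^ 2)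
      (2 • innerSL ℝ (w - x)) w := by
    have := ((hasFDerivAt_id w).sub_const x).norm_sq
    simpa using this
  refine (hG.comp_hasFDerivAt w h1).congr_fderiv ?_
  ext y
  simp
  ring

lemma gradient_comp_norm_sub_sq {G : ℝ → ℝ} {G' : ℝ} (x w : EuclideanSpace ℝ (Fin n))
    (hG : HasDerivAt G G' (‖w - x‖ ^ 2)) :
    gradient (fun w => G (‖w - x‖ ^ 2)) w = (2 * G') • (w - x) := by
  apply HasGradientAt.gradient
  rw [hasGradientAt_iff_hasFDerivAt]
  refine (hasFDerivAt_comp_norm_sub_sq x w hG).congr_fderiv ?_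
  ext y
  simp

lemma hessQ_comp_norm_sub_sq {G G' : ℝ → ℝ} {G'' : ℝ} (x w : EuclideanSpace ℝ (Fin n))
    (hG : ∀ s, HasDerivAt G (G' s) s) (hG' : HasDerivAt G' G'' (‖w - x‖ ^ 2)) :
    hessQ (fun w => G (‖w - x‖ ^ 2)) w =
      8 * G' (‖w - x‖ ^ 2) ^ 2 * ‖w - x‖ ^ 2 *
        (2 * G'' * ‖w - x‖ ^ 2 + G' (‖w - x‖ ^ 2)) := by
  have hfd : fderiv ℝ (fun w => G (‖w - x‖ ^ 2)) =
      fun w => (2 * G' (‖w - x‖ ^ 2)) • innerSL ℝ (w - x) := by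
    funext z
    exact (hasFDerivAt_comp_norm_sub_sq x z (hG _)).fderiv
  have h1 : HasFDerivAt (fun w => 2 * G' (‖w - x‖ ^ 2))
      ((2 : ℝ) • ((2 * G'') • innerSL ℝ (w - x))) w :=
    (hasFDerivAt_comp_norm_sub_sq x w hG').const_mul 2
  let J : EuclideanSpace ℝ (Fin n) →L[ℝ] EuclideanSpace ℝ (Fin n) →L[ℝ] ℝ := innerSL ℝ
  have hJ : ∀ d, J d d = ‖d‖ ^ 2 := real_inner_self_eq_norm_sq
  have h2 : HasFDerivAt (fun w : EuclideanSpace ℝ (Fin n) => innerSL ℝ (w - x)) J w :=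
    J.hasFDerivAt.comp w ((hasFDerivAt_id w).sub_const x)
  unfold hessQ
  rw [iteratedFDeriv_two_apply, hfd, (h1.fun_smul h2).fderiv,
    gradient_comp_norm_sub_sq x w (hG _)]
  generalize w - x = d
  simp [hJ]
  ring

lemma gradient_neg_fun (φ : EuclideanSpace ℝ (Fin n) → ℝ) (x : EuclideanSpace ℝ (Fin n)) :
    gradient (fun y => -φ y) x = -gradient φ x := by
  unfold gradient
  rw [fderiv_fun_neg, map_neg]

lemma hessQ_neg_fun (φ : EuclideanSpace ℝ (Fin n) → ℝ) (x : EuclideanSpace ℝ (Fin n)) :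
    hessQ (fun y => -φ y) x = -hessQ φ x := by
  unfold hessQ
  have : fderiv ℝ (fun y => -φ y) = fun y => -fderiv ℝ φ y := by
    funext y
    exact fderiv_fun_neg
  rw [iteratedFDeriv_two_apply, iteratedFDeriv_two_apply, gradient_neg_fun, this, fderiv_fun_neg]
  simp

end RadialCalculus

/-- The third order Taylor polynomial of `√s` at `r ^ 2` lies above `√s`. -/
lemma le_sqrt_taylor {r ρ : ℝ} (hr : 0 < r) (hρ : 0 ≤ ρ) :
    ρ ≤ r + (ρ ^ 2 - r ^ 2) / (2 * r) - (ρ ^ 2 - r ^ 2) ^ 2 / (8 * r ^ 3)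
      + (ρ ^ 2 - r ^ 2) ^ 3 / (16 * r ^ 5) := by
  have : r + (ρ ^ 2 - r ^ 2) / (2 * r) - (ρ ^ 2 - r ^ 2) ^ 2 / (8 * r ^ 3)
      + (ρ ^ 2 - r ^ 2) ^ 3 / (16 * r ^ 5) - ρ
      = (ρ - r) ^ 4 * (ρ ^ 2 + 4 * ρ * r + 5 * r ^ 2) / (16 * r ^ 5) := by
    field_simp
    ring
  have h2 : 0 ≤ (ρ - r) ^ 4 * (ρ ^ 2 + 4 * ρ * r + 5 * r ^ 2) / (16 * r ^ 5) := by positivity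
  linarith

/-- If a function violates comparison with a cone, it can be touched from above by a smooth
function whose gradient is at least the slope of the cone and which is strictly infinity
superharmonic at the contact point. -/
lemma exists_touching_of_cone_violation {n : ℕ} {w : EuclideanSpace ℝ (Fin n) → ℝ}
    {x y : EuclideanSpace ℝ (Fin n)} {R a : ℝ} (hw : ContinuousOn w (closedBall x R))
    (ha : 0 ≤ a) (hwR : ∀ z ∈ closedBall x R, w z ≤ w x + a * R)
    (hy : y ∈ closedBall x R) (hviol : w x + a * ‖y - x‖ < w y) :
    ∃ z ∈ ball x R, ∃ ψ : EuclideanSpace ℝ (Fin n) → ℝ, ContDiff ℝ 2 ψ ∧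
      IsLocalMax (fun p => w p - ψ p) z ∧ a ≤ ‖gradient ψ z‖ ∧ hessQ ψ z < 0 := by
  have hyR : ‖y - x‖ ≤ R := by simpa [dist_eq_norm] using hy
  have hR : 0 < R := by
    rcases (norm_nonneg (y - x)).eq_or_lt with h | h
    · have : y = x := sub_eq_zero.1 (norm_eq_zero.1 h.symm)
      subst this
      simp at hviol
    · linarith
  obtain ⟨b, hb, hbv⟩ : ∃ b : ℝ, 0 < b ∧ w x + a * ‖y - x‖ + 2 * b * R * R < w y := by
    refine ⟨(w y - (w x + a * ‖y - x‖)) / (4 * R * R),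
      div_pos (by linarith) (by positivity), ?_⟩
    have : 2 * ((w y - (w x + a * ‖y - x‖)) / (4 * R * R)) * R * R
      = (w y - (w x + a * ‖y - x‖)) / 2 := by field_simp; ring
    rw [this]
    linarith
  set a' := a + 2 * b * R with ha'
  have hcont : ContinuousOn (fun p => w p - (a' * ‖p - x‖ - b * ‖p - x‖ ^ 2)) (closedBall x R) :=
    hw.sub (by fun_prop)
  obtain ⟨z, hz, hmax⟩ := (isCompact_closedBall x R).exists_isMaxOn ⟨y, hy⟩ hcont
  have hzy : w x < w z - (a' * ‖z - x‖ - b * ‖z - x‖ ^ 2) := by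
    have h1 := hmax hy
    simp only [mem_ofPred_eq] at h1
    have h2 : 2 * b * R * ‖y - x‖ ≤ 2 * b * R * R := by gcongr
    have h3 : 0 ≤ b * ‖y - x‖ ^ 2 := by positivity
    rw [ha'] at *
    linarith [add_mul a (2 * b * R) ‖y - x‖]
  have hzR : ‖z - x‖ ≤ R := by simpa [dist_eq_norm] using hz
  have hz0 : 0 < ‖z - x‖ := by
    rcases (norm_nonneg (z - x)).eq_or_lt with h | h
    · have : z = x := sub_eq_zero.1 (norm_eq_zero.1 h.symm)
      subst this
      simp at hzy
    · exact h
  have hzlt : ‖z - x‖ < R := by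
    refine lt_of_le_of_ne hzR fun h => ?_
    have := hwR z hz
    rw [h, ha'] at hzy
    nlinarith [mul_pos hb (mul_pos hR hR)]
  have hzb : z ∈ ball x R := by simpa [dist_eq_norm] using hzlt
  set r := ‖z - x‖ with hr
  let G : ℝ → ℝ := fun s => a' * (r + (s - r ^ 2) / (2 * r) - (s - r ^ 2) ^ 2 / (8 * r ^ 3)
      + (s - r ^ 2) ^ 3 / (16 * r ^ 5)) - b * s
  let G' : ℝ → ℝ := fun s => a' * (1 / (2 * r) - 2 * (s - r ^ 2) / (8 * r ^ 3)
      + 3 * (s - r ^ 2) ^ 2 / (16 * r ^ 5)) - b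
  have hG : ∀ s, HasDerivAt G (G' s) s := by
    intro s
    have h1 : HasDerivAt (fun s : ℝ => s - r ^ 2) 1 s := (hasDerivAt_id s).sub_const _
    have := ((((h1.div_const (2 * r)).const_add r).sub ((h1.pow 2).div_const (8 * r ^ 3))).add
      ((h1.pow 3).div_const (16 * r ^ 5))).const_mul a' |>.sub ((hasDerivAt_id s).const_mul b)
    refine this.congr_deriv ?_
    simp [G']
  have hG' : HasDerivAt G' (a' * (-(2 / (8 * r ^ 3)))) (r ^ 2) := by
    have h1 : HasDerivAt (fun s : ℝ => s - r ^ 2) 1 (r ^ 2) := (hasDerivAt_id _).sub_const _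
    have := (((((h1.const_mul 2).div_const (8 * r ^ 3)).const_sub (1 / (2 * r))).add
      (((h1.pow 2).const_mul 3).div_const (16 * r ^ 5))).const_mul a').sub_const b
    refine this.congr_deriv ?_
    simp
  have hG'r : G' (r ^ 2) = a' / (2 * r) - b := by
    simp [G']
    ring
  have hgr : 2 * G' (r ^ 2) * r = a' - 2 * b * r := by
    rw [hG'r]; field_simp
  have hpos : a < 2 * G' (r ^ 2) * r := by
    rw [hgr, ha']
    nlinarith
  refine ⟨z, hzb, fun p => G (‖p - x‖ ^ 2), ?_, ?_, ?_, ?_⟩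
  · have hGc : ContDiff ℝ 2 G := by
      simp only [G]
      fun_prop
    exact hGc.comp ((contDiff_id.sub contDiff_const).norm_sq ℝ)
  · filter_upwards [isOpen_ball.mem_nhds hzb] with p hp
    have h1 := hmax (ball_subset_closedBall hp)
    simp only [mem_ofPred_eq] at h1
    have h2 := mul_le_mul_of_nonneg_left (le_sqrt_taylor hz0 (norm_nonneg (p - x)))
      (show 0 ≤ a' by positivity)
    have h3 : G (‖z - x‖ ^ 2) = a' * r - b * r ^ 2 := by simp [G, hr]
    rw [h3]
    simp only [G]
    linarith
  · rw [gradient_comp_norm_sub_sq x z (hG _), norm_smul]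
    rw [← hr, Real.norm_eq_abs]
    calc a ≤ 2 * G' (r ^ 2) * r := hpos.le
      _ ≤ _ := by gcongr; exact le_abs_self _
  · rw [hessQ_comp_norm_sub_sq x z hG hG', ← hr]
    have h1 : 2 * (a' * (-(2 / (8 * r ^ 3)))) * r ^ 2 + G' (r ^ 2) = -b := by
      rw [hG'r]; field_simp; ring
    rw [h1]
    have h2 : G' (r ^ 2) ≠ 0 := by
      intro h
      rw [h] at hpos
      simp at hpos
      linarith
    have : 0 < 8 * G' (r ^ 2) ^ 2 * r ^ 2 := by positivity
    nlinarith

lemma IsFSub.le_cone {n : ℕ} {Ω : Set (EuclideanSpace ℝ (Fin n))} {f : ℝ → ℝ}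
    {u : EuclideanSpace ℝ (Fin n) → ℝ} (hu : IsFSub Ω f u)
    {x y : EuclideanSpace ℝ (Fin n)} {R a : ℝ} (huc : ContinuousOn u (closedBall x R))
    (hsub : closedBall x R ⊆ Ω) (ha : 0 ≤ a) (hfa : ∀ z ∈ closedBall x R, f (u z) < a)
    (huR : ∀ z ∈ closedBall x R, u z ≤ u x + a * R) (hy : y ∈ closedBall x R) :
    u y ≤ u x + a * ‖y - x‖ := by
  by_contra! hviol
  obtain ⟨z, hz, ψ, hψ, hmax, hgrad, hhess⟩ :=
    exists_touching_of_cone_violation huc ha huR hy hviol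
  have hz' := ball_subset_closedBall hz
  rcases min_le_iff.1 (hu z (hsub hz') ψ hψ (hmax.on Ω)) with h | h
  · linarith [hfa z hz']
  · linarith

lemma IsFSuper.cone_le {n : ℕ} {Ω : Set (EuclideanSpace ℝ (Fin n))} {f : ℝ → ℝ}
    {v : EuclideanSpace ℝ (Fin n) → ℝ} (hv : IsFSuper Ω f v)
    {x y : EuclideanSpace ℝ (Fin n)} {R a : ℝ} (hvc : ContinuousOn v (closedBall x R))
    (hsub : closedBall x R ⊆ Ω) (ha : 0 ≤ a)
    (hvR : ∀ z ∈ closedBall x R, v x - a * R ≤ v z) (hy : y ∈ closedBall x R) :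
    v x - a * ‖y - x‖ ≤ v y := by
  by_contra! hviol
  obtain ⟨z, hz, ψ, hψ, hmax, -, hhess⟩ :=
    exists_touching_of_cone_violation (w := fun p => -v p) hvc.neg ha
      (fun z hz => by linarith [hvR z hz]) hy (by linarith)
  have hmin : IsLocalMin (fun p => v p - -ψ p) z := by
    filter_upwards [hmax] with p hp
    linarith
  have h := (hv z (hsub (ball_subset_closedBall hz)) (fun p => -ψ p) hψ.neg (hmin.on Ω)).2
  rw [hessQ_neg_fun] at h
  linarith

lemma IsFSuper.exists_decrease {n : ℕ} {Ω : Set (EuclideanSpace ℝ (Fin n))} {f : ℝ → ℝ}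
    {v : EuclideanSpace ℝ (Fin n) → ℝ} (hv : IsFSuper Ω f v)
    {z : EuclideanSpace ℝ (Fin n)} {R m : ℝ} (hR : 0 < R) (hm : 0 < m)
    (hvc : ContinuousOn v (closedBall z R)) (hsub : closedBall z R ⊆ Ω)
    (hfm : ∀ p ∈ closedBall z R, m < f (v p)) :
    ∃ p ∈ closedBall z R, v p ≤ v z - R * m := by
  by_contra! hcon
  have hzmem : z ∈ closedBall z R := mem_closedBall_self hR.le
  obtain ⟨p₀, hp₀, hp₀min⟩ := (isCompact_closedBall z R).exists_isMinOn ⟨z, hzmem⟩ hvc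
  have hgap := hcon p₀ hp₀
  obtain ⟨δ, hδ, hδgap⟩ : ∃ δ : ℝ, 0 < δ ∧ v z + m * δ < v p₀ + m * R := by
    refine ⟨(v p₀ - (v z - R * m)) / (2 * m), by apply div_pos <;> linarith, ?_⟩
    have : m * ((v p₀ - (v z - R * m)) / (2 * m)) = (v p₀ - (v z - R * m)) / 2 := by
      field_simp
    rw [this]
    linarith
  have hcd : ContDiff ℝ 2 (fun p : EuclideanSpace ℝ (Fin n) => -(m * √(δ ^ 2 + ‖p - z‖ ^ 2))) := by
    refine (contDiff_const.mul (ContDiff.sqrt ?_ fun p => by positivity)).neg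
    exact contDiff_const.add ((contDiff_id.sub contDiff_const).norm_sq ℝ)
  obtain ⟨w, hw, hwmin⟩ := (isCompact_closedBall z R).exists_isMinOn ⟨z, hzmem⟩
    (hvc.sub hcd.continuous.continuousOn)
  have hwR : ‖w - z‖ ≤ R := by simpa [dist_eq_norm] using hw
  have hwlt : ‖w - z‖ < R := by
    refine lt_of_le_of_ne hwR fun h => ?_
    have h1 := hwmin hzmem
    have h2 := hp₀min hw
    simp only [mem_ofPred_eq, Pi.sub_apply, sub_self, norm_zero, h] at h1 h2
    have h3 : √(δ ^ 2 + 0 ^ 2) = δ := by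
      rw [zero_pow two_ne_zero, add_zero, Real.sqrt_sq hδ.le]
    have h4 : R ≤ √(δ ^ 2 + R ^ 2) := Real.le_sqrt_of_sq_le (by nlinarith)
    rw [h3] at h1
    nlinarith
  have hwb : w ∈ ball z R := by simpa [dist_eq_norm] using hwlt
  have hlm : IsLocalMin (fun p => v p - -(m * √(δ ^ 2 + ‖p - z‖ ^ 2))) w := by
    filter_upwards [isOpen_ball.mem_nhds hwb] with p hp
    exact hwmin (ball_subset_closedBall hp)
  have h := (hv w (hsub hw) _ hcd (hlm.on Ω)).1
  set S := √(δ ^ 2 + ‖w - z‖ ^ 2) with hS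
  have hSpos : 0 < S := Real.sqrt_pos.2 (by positivity)
  have hder : HasDerivAt (fun s => -(m * √(δ ^ 2 + s))) (-(m * (1 / (2 * S)))) (‖w - z‖ ^ 2) :=
    ((((hasDerivAt_id _).const_add (δ ^ 2)).sqrt
      (by simp only [id]; positivity)).const_mul m).neg
  rw [gradient_comp_norm_sub_sq z w hder, norm_smul, Real.norm_eq_abs] at h
  have habs : |2 * -(m * (1 / (2 * S)))| = m / S := by
    rw [mul_neg, abs_neg, abs_of_pos (by positivity)]
    field_simp
  rw [habs] at h
  have hle : ‖w - z‖ ≤ S := Real.le_sqrt_of_sq_le (by nlinarith)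
  have : m / S * ‖w - z‖ ≤ m := by
    rw [div_mul_eq_mul_div, div_le_iff₀ hSpos]
    gcongr
  linarith [hfm w hw]

/-- If `u ^ p - v ^ p` is maximal at `(v₀, u₀)`, the line through `(v₀, u₀)` with slope
`(u₀ / v₀) ^ (1 - p)` lies strictly above all other values `(v, u)`. -/
lemma le_tangent_of_rpow_sub_rpow_le {p u₀ v₀ u v : ℝ} (hp : p ∈ Ioo (0 : ℝ) 1) (hv₀ : 0 < v₀)
    (huv₀ : v₀ < u₀) (hu : 0 ≤ u) (hv : 0 ≤ v) (h : u ^ p - v ^ p ≤ u₀ ^ p - v₀ ^ p) :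
    u - (u₀ / v₀) ^ (1 - p) * v ≤ u₀ - (u₀ / v₀) ^ (1 - p) * v₀ ∧
    (u₀ - (u₀ / v₀) ^ (1 - p) * v₀ ≤ u - (u₀ / v₀) ^ (1 - p) * v → v = v₀ ∧ u = u₀) := by
  have hu₀ : 0 < u₀ := hv₀.trans huv₀
  set l := (v₀ / u₀) ^ p with hl
  have hl0 : 0 < l := by positivity
  have hl1 : l < 1 := Real.rpow_lt_one (by positivity) ((div_lt_one hu₀).2 huv₀) hp.1
  have hconc : v ≠ v₀ → l * (v / v₀) ^ p + (1 - l) < (l * (v / v₀) + (1 - l)) ^ p := by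
    intro hne
    have hne' : v / v₀ ≠ 1 := fun h' => hne ((div_eq_one_iff_eq hv₀.ne').1 h')
    have := (Real.strictConcaveOn_rpow hp.1 hp.2).2
      (show v / v₀ ∈ Ici (0 : ℝ) from div_nonneg hv hv₀.le)
      (mem_Ici.2 (zero_le_one' ℝ)) hne' hl0 (sub_pos.2 hl1) (by ring)
    simpa using this
  have hratio : (u / u₀) ^ p ≤ l * (v / v₀) ^ p + (1 - l) := by
    rw [hl, Real.div_rpow hu hu₀.le, Real.div_rpow hv hv₀.le, Real.div_rpow hv₀.le hu₀.le]
    have h1 : 0 < u₀ ^ p := by positivity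
    have h2 : 0 < v₀ ^ p := by positivity
    have : v₀ ^ p / u₀ ^ p * (v ^ p / v₀ ^ p) + (1 - v₀ ^ p / u₀ ^ p)
      = (v ^ p + u₀ ^ p - v₀ ^ p) / u₀ ^ p := by field_simp; ring
    rw [this]
    gcongr
    linarith
  have hslope : u₀ * l = (u₀ / v₀) ^ (1 - p) * v₀ := by
    rw [hl, Real.rpow_sub (by positivity), Real.rpow_one, Real.div_rpow hv₀.le hu₀.le,
      Real.div_rpow hu₀.le hv₀.le]
    field_simp
  set t := (u₀ / v₀) ^ (1 - p) with ht
  have key : v ≠ v₀ → u - t * v < u₀ - t * v₀ := by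
    intro hne
    have h1 : (u / u₀) ^ p < (l * (v / v₀) + (1 - l)) ^ p := hratio.trans_lt (hconc hne)
    have h2 : u / u₀ < l * (v / v₀) + (1 - l) :=
      (Real.rpow_lt_rpow_iff (by positivity)
        (add_nonneg (by positivity) (sub_nonneg.2 hl1.le)) hp.1).1 h1
    rw [div_lt_iff₀ hu₀] at h2
    have h3 : (l * (v / v₀) + (1 - l)) * u₀ = u₀ * l * (v / v₀) + u₀ - u₀ * l := by ring
    rw [h3, hslope] at h2
    have h4 : t * v₀ * (v / v₀) = t * v := by field_simp
    linarith
  have keq : v = v₀ → u ≤ u₀ := by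
    intro he
    rw [he] at h
    exact (Real.rpow_le_rpow_iff hu hu₀.le hp.1).1 (by linarith)
  by_cases he : v = v₀
  · have := keq he
    subst he
    exact ⟨by linarith, fun h' => ⟨rfl, by linarith⟩⟩
  · exact ⟨(key he).le, fun h' => absurd h' (not_le.2 (key he))⟩

/-- A constrained doubling of variables: near the maximum points of `u - t * v` one cannot have
`f (u) < β₁ < β₂ < t * f (v)`. -/
lemma no_interior_max_of_gap {n : ℕ} {Ω : Set (EuclideanSpace ℝ (Fin n))}
    (hΩb : Bornology.IsBounded Ω) {f : ℝ → ℝ}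
    {u v : EuclideanSpace ℝ (Fin n) → ℝ}
    (huc : ContinuousOn u (closure Ω)) (hvc : ContinuousOn v (closure Ω))
    (hu : IsFSub Ω f u) (hv : IsFSuper Ω f v) {t β₁ β₂ D : ℝ} (ht : 0 < t) (hβ₁ : 0 < β₁)
    (hβ : β₁ < β₂) {O : Set (EuclideanSpace ℝ (Fin n))} (hO : IsOpen O) (hOΩ : O ⊆ Ω)
    (hOu : ∀ x ∈ O, f (u x) < β₁) (hOv : ∀ x ∈ O, β₂ < t * f (v x))
    (hD : ∃ x ∈ closure Ω, u x - t * v x = D)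
    (hE : ∀ x ∈ closure Ω, D ≤ u x - t * v x → x ∈ O) : False := by
  set K := closure Ω with hK
  have hKc : IsCompact K := hΩb.isCompact_closure
  have hgc : ContinuousOn (fun x => u x - t * v x) K := huc.sub (hvc.const_smul t)
  have hg2 : ContinuousOn
      (fun q : EuclideanSpace ℝ (Fin n) × EuclideanSpace ℝ (Fin n) => u q.1 - t * v q.2)
      (K ×ˢ K) :=
    (huc.comp continuousOn_fst fun q hq => hq.1).sub
      ((hvc.comp continuousOn_snd fun q hq => hq.2).const_smul t)
  have hEc : IsCompact {x ∈ K | D ≤ u x - t * v x} :=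
    hKc.of_isClosed_subset (hgc.preimage_isClosed_of_isClosed hKc.isClosed isClosed_Ici)
      (fun x hx => hx.1)
  obtain ⟨ρ, hρ, hρO⟩ := hEc.exists_thickening_subset_open hO (fun x hx => hE x hx.1 hx.2)
  set E := {x ∈ K | D ≤ u x - t * v x} with hEdef
  have hQc : IsCompact ({q ∈ K ×ˢ K | D ≤ u q.1 - t * v q.2} ∩
      {q | q.1 ∉ thickening (ρ / 2) E}) := by
    refine ((hKc.prod hKc).of_isClosed_subset (hg2.preimage_isClosed_of_isClosed
      (hKc.prod hKc).isClosed isClosed_Ici) (fun x hx => hx.1)).inter_right ?_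
    exact (isOpen_thickening.isClosed_compl).preimage continuous_fst
  obtain ⟨δ, hδ, hδQ⟩ := hQc.exists_forall_le' (f := fun q => dist q.1 q.2) (a := 0)
    continuous_dist.continuousOn (by
      rintro ⟨y, z⟩ ⟨⟨⟨hy, hz⟩, hyz⟩, hyE⟩
      refine dist_pos.2 fun h => hyE ?_
      simp only at h hyz hy hz ⊢
      subst h
      exact self_subset_thickening (by linarith) E ⟨hy, hyz⟩)
  obtain ⟨ε, hε, hεδ, hερ⟩ : ∃ ε : ℝ, 0 < ε ∧ 2 * ε < δ ∧ 4 * ε < ρ / 2 :=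
    ⟨min (δ / 3) (ρ / 9), by positivity, by linarith [min_le_left (δ / 3) (ρ / 9)],
      by linarith [min_le_right (δ / 3) (ρ / 9)]⟩
  set P := {q ∈ K ×ˢ K | dist q.1 q.2 ≤ 2 * ε} with hP
  have hPc : IsCompact P :=
    (hKc.prod hKc).inter_right (isClosed_le continuous_dist continuous_const)
  obtain ⟨x₀, hx₀, hx₀D⟩ := hD
  obtain ⟨q₀, hq₀, hq₀max⟩ := hPc.exists_isMaxOn
    ⟨(x₀, x₀), ⟨hx₀, hx₀⟩, by simpa using hε.le⟩ (hg2.mono fun q hq => hq.1)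
  set L := u q₀.1 - t * v q₀.2 with hL
  have hPL : ∀ y ∈ K, ∀ z ∈ K, dist y z ≤ 2 * ε → u y - t * v z ≤ L := fun y hy z hz hyz =>
    hq₀max (show (y, z) ∈ P from ⟨⟨hy, hz⟩, hyz⟩)
  have hDL : D ≤ L := hx₀D ▸ hPL x₀ hx₀ x₀ hx₀ (by simpa using hε.le)
  have hMc : IsCompact {q ∈ P | L ≤ u q.1 - t * v q.2} :=
    hPc.of_isClosed_subset ((hg2.mono fun q hq => hq.1).preimage_isClosed_of_isClosed
      hPc.isClosed isClosed_Ici) (fun x hx => hx.1)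
  obtain ⟨⟨y, z⟩, ⟨⟨⟨hy, hz⟩, hyz⟩, hyzL⟩, hymax⟩ :=
    hMc.exists_isMaxOn (f := fun q => u q.1) ⟨q₀, hq₀, le_rfl⟩
      (huc.comp continuousOn_fst fun q hq => hq.1.1.1)
  simp only at hy hz hyz hyzL
  have hyzL' : u y - t * v z = L := le_antisymm (hPL y hy z hz hyz) hyzL
  have hyE : y ∈ thickening (ρ / 2) E := by
    by_contra h
    exact absurd (hδQ (y, z) ⟨⟨⟨hy, hz⟩, by simp only; linarith⟩, h⟩) (by simp only; linarith)
  have hyO : closedBall y (4 * ε) ⊆ O := by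
    intro p hp
    apply hρO
    obtain ⟨e, he, hye⟩ := mem_thickening_iff.1 hyE
    refine mem_thickening_iff.2 ⟨e, he, ?_⟩
    linarith [dist_triangle p y e, mem_closedBall.1 hp]
  have hOK : O ⊆ K := hOΩ.trans subset_closure
  set x := midpoint ℝ y z with hx
  have hyx : dist y x ≤ ε := by
    rw [hx, dist_left_midpoint]; simp; linarith
  have hzx : dist z x ≤ ε := by
    rw [hx, dist_right_midpoint]; simp; linarith
  have hxO : closedBall x (2 * ε) ⊆ O := fun p hp => hyO (by
    rw [mem_closedBall] at hp ⊢
    linarith [dist_triangle p x y, dist_comm x y])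
  have hzx2 : closedBall z ε ⊆ closedBall x (2 * ε) := fun p hp => by
    rw [mem_closedBall] at hp ⊢
    linarith [dist_triangle p z x]
  have hxx : x ∈ closedBall x (2 * ε) := mem_closedBall_self (by linarith)
  have hyx2 : y ∈ closedBall x (2 * ε) := by rw [mem_closedBall]; linarith
  have hzx2' : z ∈ closedBall x (2 * ε) := by rw [mem_closedBall]; linarith
  have huB : ContinuousOn u (closedBall x (2 * ε)) := huc.mono (hxO.trans hOK)
  have hvB : ContinuousOn v (closedBall x (2 * ε)) := hvc.mono (hxO.trans hOK)
  obtain ⟨y', hy', hy'max⟩ := (isCompact_closedBall x (2 * ε)).exists_isMaxOn ⟨x, hxx⟩ huB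
  obtain ⟨z', hz', hz'min⟩ := (isCompact_closedBall x (2 * ε)).exists_isMinOn ⟨x, hxx⟩ hvB
  have hxK : x ∈ K := hOK (hxO hxx)
  have hpair₁ : u y' - t * v x ≤ L := hPL y' (hOK (hxO hy')) x hxK hy'
  have hpair₂ : u x - t * v z' ≤ L := hPL x hxK z' (hOK (hxO hz')) (by
    rw [dist_comm]; exact hz')
  have hdec : ε * β₂ ≤ t * (v z - v z') := by
    obtain ⟨p, hp, hpv⟩ := hv.exists_decrease (m := β₂ / t) hε (div_pos (hβ₁.trans hβ) ht)
      (hvB.mono hzx2) ((hzx2.trans hxO).trans hOΩ) (fun p hp => by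
        rw [div_lt_iff₀ ht, mul_comm]
        exact hOv p (hxO (hzx2 hp)))
    have h1 : v z' ≤ v p := hz'min (hzx2 hp)
    have h2 : ε * β₂ = t * (ε * (β₂ / t)) := by field_simp
    rw [h2]
    gcongr
    linarith
  -- discrete superharmonicity of `v`
  have hvdisc : v x - v z ≤ v z - v z' := by
    have h0 : v z' ≤ v x := hz'min hxx
    have h1 := hv.cone_le (a := (v x - v z') / (2 * ε)) hvB (hxO.trans hOΩ)
      (div_nonneg (by linarith) (by linarith)) (fun p hp => by
        rw [div_mul_cancel₀ _ (by positivity)]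
        linarith [show v z' ≤ v p from hz'min hp]) hzx2'
    rw [← dist_eq_norm] at h1
    have h2 : (v x - v z') / (2 * ε) * dist z x ≤ (v x - v z') / (2 * ε) * ε :=
      mul_le_mul_of_nonneg_left hzx (div_nonneg (by linarith) (by linarith))
    have h3 : (v x - v z') / (2 * ε) * ε = (v x - v z') / 2 := by field_simp
    linarith
  -- discrete subharmonicity of `u`
  have hudisc : u y - u x ≤ max (ε * β₁) ((u y' - u x) / 2) := by
    have h0 : u x ≤ u y' := hy'max hxx
    set a := max β₁ ((u y' - u x) / (2 * ε)) with ha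
    have ha0 : 0 ≤ a := hβ₁.le.trans (le_max_left _ _)
    have h1 := hu.le_cone (a := a) huB (hxO.trans hOΩ) ha0
      (fun p hp => (hOu p (hxO hp)).trans_le (le_max_left _ _)) (fun p hp => by
        have h2 : (u y' - u x) / (2 * ε) * (2 * ε) ≤ a * (2 * ε) := by
          gcongr
          exact le_max_right _ _
        rw [div_mul_cancel₀ _ (by positivity)] at h2
        linarith [show u p ≤ u y' from hy'max hp]) hyx2
    rw [← dist_eq_norm] at h1
    have h2 : a * dist y x ≤ ε * a := by
      rw [mul_comm]
      gcongr
    have h3 : ε * a = max (ε * β₁) ((u y' - u x) / 2) := by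
      rw [ha, mul_max_of_nonneg _ _ hε.le]
      congr 1
      field_simp
    linarith
  have hεβ : ε * β₁ < ε * β₂ := by gcongr
  have htv : t * (v x - v z) ≤ t * (v z - v z') := by gcongr
  rcases le_max_iff.1 hudisc with h | h
  · linarith
  · have hcontra : u y' ≤ u y := hymax (show (y', x) ∈ {q ∈ P | L ≤ u q.1 - t * v q.2} from
      ⟨⟨⟨hOK (hxO hy'), hxK⟩, hy'⟩, by simp only; linarith⟩)
    linarith [mul_pos hε hβ₁]

/-- Comparison principle for small sub/supersolutions of
`min{|∇w| − f(w), −Δ_∞ w} = 0` when `f(t)/t^q` is positive and non-increasing on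
`(0, c)` for some `q ∈ (0,1)` and `0 < c ≤ ∞`. -/
theorem comparison_small_solutions {n : ℕ} (Ω : Set (EuclideanSpace ℝ (Fin n)))
    (hΩo : IsOpen Ω) (hΩb : Bornology.IsBounded Ω)
    (f : ℝ → ℝ) (hf : Continuous f)
    (c : ENNReal) (hc : 0 < c) (q : ℝ) (hq : q ∈ Set.Ioo (0:ℝ) 1)
    (hf_pos : ∀ t : ℝ, 0 < t → ENNReal.ofReal t < c → 0 < f t / t ^ q)
    (hf_mono : ∀ s t : ℝ, 0 < s → s ≤ t → ENNReal.ofReal t < c →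
      f t / t ^ q ≤ f s / s ^ q)
    (u v : EuclideanSpace ℝ (Fin n) → ℝ)
    (hu_cont : ContinuousOn u (closure Ω)) (hv_cont : ContinuousOn v (closure Ω))
    (hu_pos : ∀ x ∈ Ω, 0 < u x) (hv_pos : ∀ x ∈ Ω, 0 < v x)
    (hsmall : ENNReal.ofReal
      (max (sSup ((fun x => |u x|) '' closure Ω)) (sSup ((fun x => |v x|) '' closure Ω))) < c)
    (hu_sub : IsFSub Ω f u) (hv_super : IsFSuper Ω f v)
    (hbdry : ∀ x ∈ frontier Ω, u x ≤ v x) :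
    ∀ x ∈ closure Ω, u x ≤ v x := by
  intro x₁ hx₁
  by_contra! hcon
  have hKc : IsCompact (closure Ω) := hΩb.isCompact_closure
  have hu0 : ∀ x ∈ closure Ω, 0 ≤ u x := fun x hx =>
    le_on_closure (fun y hy => (hu_pos y hy).le) continuousOn_const hu_cont hx
  have hv0 : ∀ x ∈ closure Ω, 0 ≤ v x := fun x hx =>
    le_on_closure (fun y hy => (hv_pos y hy).le) continuousOn_const hv_cont hx
  set q' := (1 + q) / 2 with hq'
  have hqq' : q < q' := by rw [hq']; linarith [hq.2]
  have hp : 1 - q' ∈ Ioo (0 : ℝ) 1 := by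
    constructor <;> rw [hq'] <;> linarith [hq.1, hq.2]
  obtain ⟨x₀, hx₀, hx₀max⟩ := hKc.exists_isMaxOn ⟨x₁, hx₁⟩
    ((hu_cont.rpow_const fun _ _ => Or.inr hp.1.le).sub
      (hv_cont.rpow_const (p := 1 - q') fun _ _ => Or.inr hp.1.le))
  have huv₀ : v x₀ < u x₀ := by
    have h1 : u x₁ ^ (1 - q') - v x₁ ^ (1 - q') ≤ u x₀ ^ (1 - q') - v x₀ ^ (1 - q') := hx₀max hx₁
    have h2 := Real.rpow_lt_rpow (hv0 x₁ hx₁) hcon hp.1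
    exact (Real.rpow_lt_rpow_iff (hv0 x₀ hx₀) (hu0 x₀ hx₀) hp.1).1 (by linarith)
  have hmemΩ : ∀ x ∈ closure Ω, v x < u x → x ∈ Ω := fun x hx hlt => by
    by_contra hxΩ
    refine absurd (hbdry x ⟨hx, ?_⟩) (not_le.2 hlt)
    rwa [hΩo.interior_eq]
  have hv₀ : 0 < v x₀ := hv_pos x₀ (hmemΩ x₀ hx₀ huv₀)
  have hu₀ : 0 < u x₀ := hv₀.trans huv₀
  have huc : ENNReal.ofReal (u x₀) < c := by
    refine (ENNReal.ofReal_le_ofReal ?_).trans_lt hsmall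
    refine le_max_of_le_left ((le_abs_self _).trans ?_)
    exact le_csSup (hKc.image_of_continuousOn hu_cont.abs).bddAbove ⟨x₀, hx₀, rfl⟩
  have hfv : 0 < f (v x₀) := by
    have := hf_pos (v x₀) hv₀ ((ENNReal.ofReal_le_ofReal huv₀.le).trans_lt huc)
    exact (div_pos_iff_of_pos_right (by positivity)).1 this
  have hfu : 0 < f (u x₀) :=
    (div_pos_iff_of_pos_right (by positivity)).1 (hf_pos (u x₀) hu₀ huc)
  set t := (u x₀ / v x₀) ^ (1 - (1 - q')) with ht
  have ht0 : 0 < t := by positivity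
  have hgap : f (u x₀) < t * f (v x₀) := by
    have h1 := hf_mono (v x₀) (u x₀) hv₀ huv₀.le huc
    rw [div_le_iff₀ (by positivity)] at h1
    have h2 : f (v x₀) / v x₀ ^ q * u x₀ ^ q = (u x₀ / v x₀) ^ q * f (v x₀) := by
      rw [Real.div_rpow hu₀.le hv₀.le]
      ring
    rw [h2] at h1
    refine h1.trans_lt (mul_lt_mul_of_pos_right ?_ hfv)
    exact Real.rpow_lt_rpow_of_exponent_lt ((one_lt_div hv₀).2 huv₀) (by linarith)
  obtain ⟨β₁, hβ₁, hβ₁'⟩ := exists_between hgap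
  obtain ⟨β₂, hβ₂, hβ₂'⟩ := exists_between hβ₁'
  have huΩ : ContinuousOn u Ω := hu_cont.mono subset_closure
  have hvΩ : ContinuousOn v Ω := hv_cont.mono subset_closure
  have hO : IsOpen ((Ω ∩ (fun x => f (u x)) ⁻¹' Iio β₁) ∩
      (Ω ∩ (fun x => t * f (v x)) ⁻¹' Ioi β₂)) :=
    ((hf.comp_continuousOn huΩ).isOpen_inter_preimage hΩo isOpen_Iio).inter
      (((hf.comp_continuousOn hvΩ).const_smul t).isOpen_inter_preimage hΩo isOpen_Ioi)
  refine no_interior_max_of_gap hΩb hu_cont hv_cont hu_sub hv_super ht0 (hfu.trans hβ₁) hβ₂ hO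
    (fun x hx => hx.1.1) (fun x hx => hx.1.2) (fun x hx => hx.2.2) ⟨x₀, hx₀, rfl⟩ ?_
  intro x hx hDx
  obtain ⟨hve, hue⟩ := (le_tangent_of_rpow_sub_rpow_le hp hv₀ huv₀ (hu0 x hx) (hv0 x hx)
    (hx₀max hx)).2 hDx
  have hxΩ : x ∈ Ω := hmemΩ x hx (by rw [hve, hue]; exact huv₀)
  refine ⟨⟨hxΩ, ?_⟩, hxΩ, ?_⟩
  · simpa [hue] using hβ₁
  · simpa [hve] using hβ₂'
end

section
/- Let Ω ⊆ ℝⁿ be a bounded open set, R_Ω := sup_{x ∈ Ω} dist(x, ∂Ω), and Λ_max := 1/(e · R_Ω). Then for every Λ with 0 < Λ ≤ Λ_max there exists a continuous function u_Λ : closure(Ω) → ℝ with u_Λ = 0 on ∂Ω that is a viscosity solution of min{|∇u| − Λ e^{u}, −Δ_∞ u} = 0 in Ω, satisfies Λ · dist(x, ∂Ω) ≤ u_Λ(x) ≤ e Λ · dist(x, ∂Ω) for all x ∈ closure(Ω), and is minimal: u_Λ ≤ u on closure(Ω) for every continuous viscosity solution u of the same problem with u = 0 on ∂Ω. -/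
open Real Set Metric Filter Topology

/-- Viscosity supersolution of `min{|∇u| − Λ e^u, −Δ_∞ u} = 0` in `Ω`. -/
def IsInftySuper {n : ℕ} (Ω : Set (EuclideanSpace ℝ (Fin n))) (Λ : ℝ)
    (u : EuclideanSpace ℝ (Fin n) → ℝ) : Prop :=
  ∀ x₀ ∈ Ω, ∀ φ : EuclideanSpace ℝ (Fin n) → ℝ, ContDiff ℝ 2 φ →
    IsLocalMinOn (fun x => u x - φ x) Ω x₀ →
    (0 ≤ ‖gradient φ x₀‖ - Λ * Real.exp (u x₀) ∧ 0 ≤ -(hessQ φ x₀))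

/-- Viscosity subsolution of `min{|∇u| − Λ e^u, −Δ_∞ u} = 0` in `Ω`. -/
def IsInftySub {n : ℕ} (Ω : Set (EuclideanSpace ℝ (Fin n))) (Λ : ℝ)
    (u : EuclideanSpace ℝ (Fin n) → ℝ) : Prop :=
  ∀ x₀ ∈ Ω, ∀ φ : EuclideanSpace ℝ (Fin n) → ℝ, ContDiff ℝ 2 φ →
    IsLocalMaxOn (fun x => u x - φ x) Ω x₀ →
    min (‖gradient φ x₀‖ - Λ * Real.exp (u x₀)) (-(hessQ φ x₀)) ≤ 0

/-- Viscosity solution of `min{|∇u| − Λ e^u, −Δ_∞ u} = 0` in `Ω`. -/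
def IsInftySol {n : ℕ} (Ω : Set (EuclideanSpace ℝ (Fin n))) (Λ : ℝ)
    (u : EuclideanSpace ℝ (Fin n) → ℝ) : Prop :=
  IsInftySuper Ω Λ u ∧ IsInftySub Ω Λ u

section Calculus

variable {E : Type*} [NormedAddCommGroup E] [NormedSpace ℝ E]

/-- The value of a derivative at a vector, differentiated along a line. -/
lemma hasDerivAt_fderiv_line {φ : E → ℝ} (hφ : ContDiff ℝ 2 φ) (x g : E) :
    HasDerivAt (fun t : ℝ => fderiv ℝ φ (x + t • g) g)
      (fderiv ℝ (fderiv ℝ φ) x g g) 0 := by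
  have h1 : DifferentiableAt ℝ (fderiv ℝ φ) (x + (0 : ℝ) • g) :=
    (hφ.fderiv_right (m := 1) (by norm_num)).differentiable (by norm_num) _
  have h2 : HasDerivAt (fun t : ℝ => x + t • g) g 0 := by
    simpa using ((hasDerivAt_id (0 : ℝ)).smul_const g).const_add x
  have h3 := h1.hasFDerivAt.comp_hasDerivAt (0 : ℝ) h2
  have h4 := (ContinuousLinearMap.apply ℝ ℝ g).hasFDerivAt.comp_hasDerivAt (0 : ℝ) h3
  rw [zero_smul, add_zero] at h4
  exact h4

lemma hasDerivAt_line {φ : E → ℝ} (hφ : ContDiff ℝ 2 φ) (x g : E) (t : ℝ) :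
    HasDerivAt (fun t : ℝ => φ (x + t • g)) (fderiv ℝ φ (x + t • g) g) t := by
  have h2 : HasDerivAt (fun t : ℝ => x + t • g) g t := by
    simpa using ((hasDerivAt_id t).smul_const g).const_add x
  exact ((hφ.differentiable (by norm_num) (x + t • g)).hasFDerivAt).comp_hasDerivAt t h2

/-- Necessary second-order condition for a local minimum on the line. -/
lemma IsLocalMin.second_deriv_nonneg {f f' : ℝ → ℝ} {b x : ℝ} (hmin : IsLocalMin f x)
    (hf : ∀ t, HasDerivAt f (f' t) t) (hf' : HasDerivAt f' b x) : 0 ≤ b := by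
  by_contra! hb
  have hd : deriv f = f' := funext fun t => (hf t).deriv
  have h0 : deriv f x = 0 := hmin.deriv_eq_zero
  have hmax : IsLocalMax f x :=
    isLocalMax_of_deriv_deriv_neg (by rw [hd, hf'.deriv]; exact hb) h0 (hf x).continuousAt
  have hc : f =ᶠ[𝓝 x] fun _ => f x := by
    filter_upwards [hmin, hmax] with t h1 h2 using le_antisymm h2 h1
  have hz : deriv (deriv f) x = 0 := by
    rw [hc.deriv.deriv_eq]; simp
  rw [hd, hf'.deriv] at hz
  exact hb.ne hz

/-- A function touched from above along a line by an affine function. -/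
lemma line_touching {φ : E → ℝ} (hφ : ContDiff ℝ 2 φ) {x g : E} {a : ℝ}
    (h : ∀ᶠ t in 𝓝 (0 : ℝ), φ (x + t • g) ≤ φ x + a * t) :
    fderiv ℝ φ x g = a ∧ fderiv ℝ (fderiv ℝ φ) x g g ≤ 0 := by
  have hm : IsLocalMin (fun t : ℝ => a * t - φ (x + t • g)) 0 := by
    filter_upwards [h] with t ht
    simp only [mul_zero, zero_smul, add_zero]
    linarith
  have hd : ∀ t, HasDerivAt (fun t : ℝ => a * t - φ (x + t • g))
      (a - fderiv ℝ φ (x + t • g) g) t := fun t => by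
    have := (hasDerivAt_id' t).const_mul a
    rw [mul_one] at this
    exact this.sub (hasDerivAt_line hφ x g t)
  have hd2 := (hasDerivAt_fderiv_line hφ x g).const_sub a
  have h1 := hm.hasDerivAt_eq_zero (hd 0)
  have h2 := hm.second_deriv_nonneg hd hd2
  simp only [zero_smul, add_zero] at h1
  exact ⟨by linarith, by linarith⟩

end Calculus

section Euclidean

variable {n : ℕ}

lemma norm_gradient_eq (φ : EuclideanSpace ℝ (Fin n) → ℝ)
    (x : EuclideanSpace ℝ (Fin n)) : ‖gradient φ x‖ = ‖fderiv ℝ φ x‖ := by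
  simp [gradient]

lemma continuous_norm_gradient {φ : EuclideanSpace ℝ (Fin n) → ℝ} (hφ : ContDiff ℝ 2 φ) :
    Continuous fun x => ‖gradient φ x‖ := by
  simp only [norm_gradient_eq]
  exact (hφ.continuous_fderiv (by norm_num)).norm

lemma continuous_gradient {φ : EuclideanSpace ℝ (Fin n) → ℝ} (hφ : ContDiff ℝ 2 φ) :
    Continuous (gradient φ) :=
  (LinearIsometryEquiv.continuous _).comp (hφ.continuous_fderiv (by norm_num))

lemma hessQ_eq (φ : EuclideanSpace ℝ (Fin n) → ℝ) (x : EuclideanSpace ℝ (Fin n)) :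
    hessQ φ x = fderiv ℝ (fderiv ℝ φ) x (gradient φ x) (gradient φ x) := by
  simp [hessQ, iteratedFDeriv_two_apply]

lemma continuous_hessQ {φ : EuclideanSpace ℝ (Fin n) → ℝ}
    (hφ : ContDiff ℝ 2 φ) : Continuous (hessQ φ) := by
  have h1 : Continuous (fderiv ℝ (fderiv ℝ φ)) :=
    (hφ.fderiv_right (m := 1) (by norm_num)).continuous_fderiv (by norm_num)
  have h2 := continuous_gradient hφ
  rw [funext (hessQ_eq φ)]
  exact (h1.clm_apply h2).clm_apply h2

/-- Comparison of gradients and infinity Laplacians at a touching point. -/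
lemma touching_comparison {φ ψ : EuclideanSpace ℝ (Fin n) → ℝ} (hφ : ContDiff ℝ 2 φ)
    (hψ : ContDiff ℝ 2 ψ) {x : EuclideanSpace ℝ (Fin n)}
    (h : IsLocalMin (fun y => ψ y - φ y) x) :
    gradient φ x = gradient ψ x ∧ hessQ φ x ≤ hessQ ψ x := by
  have hd1 := (hφ.differentiable (by norm_num) x)
  have hd2 := (hψ.differentiable (by norm_num) x)
  have hf : fderiv ℝ φ x = fderiv ℝ ψ x := by
    have := h.fderiv_eq_zero
    rw [fderiv_fun_sub hd2 hd1, sub_eq_zero] at this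
    exact this.symm
  have hg : gradient φ x = gradient ψ x := by simp [gradient, hf]
  refine ⟨hg, ?_⟩
  rw [hessQ_eq, hessQ_eq, hg]
  set g := gradient ψ x
  have hc : ContinuousAt (fun t : ℝ => x + t • g) 0 := by fun_prop
  have hline : IsLocalMin (fun t : ℝ => ψ (x + t • g) - φ (x + t • g)) 0 := by
    have h' : ∀ᶠ y in 𝓝 (x + (0 : ℝ) • g), ψ x - φ x ≤ ψ y - φ y := by
      rw [zero_smul, add_zero]
      exact h
    filter_upwards [hc.eventually h'] with t ht
    simpa using ht
  have := hline.second_deriv_nonneg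
    (fun t => (hasDerivAt_line hψ x g t).sub (hasDerivAt_line hφ x g t))
    ((hasDerivAt_fderiv_line hψ x g).sub (hasDerivAt_fderiv_line hφ x g))
  linarith

lemma hasFDerivAt_dist_sq (x₀ x : EuclideanSpace ℝ (Fin n)) :
    HasFDerivAt (fun y : EuclideanSpace ℝ (Fin n) => ‖y - x₀‖ ^ 2) (2 • innerSL ℝ (x - x₀)) x := by
  have := ((hasFDerivAt_id x).sub_const x₀).norm_sq
  simpa using this

lemma quartic_contDiff (x₀ : EuclideanSpace ℝ (Fin n)) : ContDiff ℝ 2 fun x :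
    EuclideanSpace ℝ (Fin n) => (‖x - x₀‖ ^ 2) ^ 2 :=
  ((contDiff_id.sub contDiff_const).norm_sq ℝ).pow 2

lemma fderiv_quartic (x₀ x g : EuclideanSpace ℝ (Fin n)) : fderiv ℝ (fun x :
    EuclideanSpace ℝ (Fin n) => (‖x - x₀‖ ^ 2) ^ 2) x g =
    4 * ‖x - x₀‖ ^ 2 * inner ℝ (x - x₀) g := by
  have := ((hasFDerivAt_dist_sq x₀ x).pow 2).fderiv
  rw [this]
  simp [-map_sub]
  ring

/-- Adding a multiple of the quartic does not change the two-jet at the centre. -/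
lemma quartic_perturbation {φ : EuclideanSpace ℝ (Fin n) → ℝ} (hφ : ContDiff ℝ 2 φ)
    (x₀ : EuclideanSpace ℝ (Fin n)) (c : ℝ) :
    gradient (fun x => φ x + c * (‖x - x₀‖ ^ 2) ^ 2) x₀ = gradient φ x₀ ∧
      hessQ (fun x => φ x + c * (‖x - x₀‖ ^ 2) ^ 2) x₀ = hessQ φ x₀ := by
  have hq := quartic_contDiff x₀
  have hq' : ContDiff ℝ 2 fun x => φ x + c * (‖x - x₀‖ ^ 2) ^ 2 :=
    hφ.add (contDiff_const.mul hq)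
  have hf : ∀ x g, fderiv ℝ (fun x => φ x + c * (‖x - x₀‖ ^ 2) ^ 2) x g =
      fderiv ℝ φ x g + c * (4 * ‖x - x₀‖ ^ 2 * inner ℝ (x - x₀) g) := fun x g => by
    rw [← fderiv_quartic, fderiv_fun_add (hφ.differentiable (by norm_num) x)
      ((hq.differentiable (by norm_num) x).const_mul c),
      fderiv_const_mul (hq.differentiable (by norm_num) x)]
    simp
  have hg : gradient (fun x => φ x + c * (‖x - x₀‖ ^ 2) ^ 2) x₀ = gradient φ x₀ := by
    unfold gradient
    congr 1
    ext g
    simp [hf]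
  refine ⟨hg, ?_⟩
  rw [hessQ_eq, hessQ_eq, hg]
  set g := gradient φ x₀
  have h1 := hasDerivAt_fderiv_line hq' x₀ g
  have h2 := hasDerivAt_fderiv_line hφ x₀ g
  have h3 : HasDerivAt (fun t : ℝ => c * (4 * ‖g‖ ^ 4) * t ^ 3) 0 0 := by
    simpa using (hasDerivAt_pow 3 (0 : ℝ)).const_mul (c * (4 * ‖g‖ ^ 4))
  refine h1.unique ?_
  have h4 := h2.add h3
  simp only [add_zero] at h4
  refine h4.congr_of_eventuallyEq (Eventually.of_forall fun t => ?_)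
  simp only [hf, Pi.add_apply]
  congr 1
  rw [add_sub_cancel_left, inner_smul_left, real_inner_self_eq_norm_sq, norm_smul, mul_pow]
  simp
  ring

/-- Smooth radial test function. -/
lemma radial_contDiff (x₀ : EuclideanSpace ℝ (Fin n)) {e : ℝ} (he : 0 < e) (β c : ℝ) :
    ContDiff ℝ 2 fun x : EuclideanSpace ℝ (Fin n) => c * (‖x - x₀‖ ^ 2 + e) ^ β := by
  refine contDiff_const.mul (ContDiff.rpow_const_of_ne ?_ fun x => by positivity)
  exact ((contDiff_id.sub contDiff_const).norm_sq ℝ).add contDiff_const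

lemma fderiv_radial (x₀ : EuclideanSpace ℝ (Fin n)) {e : ℝ} (he : 0 < e) (β c : ℝ)
    (x g : EuclideanSpace ℝ (Fin n)) :
    fderiv ℝ (fun x : EuclideanSpace ℝ (Fin n) => c * (‖x - x₀‖ ^ 2 + e) ^ β) x g =
      2 * c * β * (‖x - x₀‖ ^ 2 + e) ^ (β - 1) * inner ℝ (x - x₀) g := by
  have h1 := ((hasFDerivAt_dist_sq x₀ x).add_const e).rpow_const (p := β)
    (Or.inl (by positivity))
  rw [(h1.const_mul c).fderiv]
  simp [-map_sub]
  ring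

lemma gradient_radial (x₀ : EuclideanSpace ℝ (Fin n)) {e : ℝ} (he : 0 < e) (β c : ℝ)
    (x : EuclideanSpace ℝ (Fin n)) :
    gradient (fun x : EuclideanSpace ℝ (Fin n) => c * (‖x - x₀‖ ^ 2 + e) ^ β) x =
      (2 * c * β * (‖x - x₀‖ ^ 2 + e) ^ (β - 1)) • (x - x₀) := by
  refine ext_inner_right ℝ fun g => ?_
  rw [inner_gradient_left, fderiv_radial x₀ he, inner_smul_left]
  simp

lemma hessQ_radial (x₀ : EuclideanSpace ℝ (Fin n)) {e : ℝ} (he : 0 < e) (β c : ℝ)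
    (x : EuclideanSpace ℝ (Fin n)) :
    hessQ (fun x : EuclideanSpace ℝ (Fin n) => c * (‖x - x₀‖ ^ 2 + e) ^ β) x =
      2 * c * β * (2 * c * β * (‖x - x₀‖ ^ 2 + e) ^ (β - 1)) ^ 2 * ‖x - x₀‖ ^ 2 *
        (‖x - x₀‖ ^ 2 + e) ^ (β - 2) * ((2 * β - 1) * ‖x - x₀‖ ^ 2 + e) := by
  rw [hessQ_eq, gradient_radial x₀ he]
  set k := 2 * c * β * (‖x - x₀‖ ^ 2 + e) ^ (β - 1)
  refine (hasDerivAt_fderiv_line (radial_contDiff x₀ he β c) x _).unique ?_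
  simp only [fderiv_radial x₀ he]
  have hl : HasDerivAt (fun t : ℝ => x + t • k • (x - x₀)) (k • (x - x₀)) 0 := by
    simpa using ((hasDerivAt_id (0 : ℝ)).smul_const (k • (x - x₀))).const_add x
  have hq : HasDerivAt (fun t : ℝ => ‖x + t • k • (x - x₀) - x₀‖ ^ 2 + e)
      (2 * k * ‖x - x₀‖ ^ 2) 0 := by
    have := ((hl.sub_const x₀).norm_sq).add_const e
    refine this.congr_deriv ?_
    simp [inner_smul_right]
    ring
  have hp := (hq.rpow_const (p := β - 1) (Or.inl (by positivity))).const_mul (2 * c * β)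
  have hi : HasDerivAt (fun t : ℝ => inner ℝ (x + t • k • (x - x₀) - x₀) (k • (x - x₀)))
      (k ^ 2 * ‖x - x₀‖ ^ 2) 0 := by
    have := (hl.sub_const x₀).inner ℝ (hasDerivAt_const (0 : ℝ) (k • (x - x₀)))
    refine this.congr_deriv ?_
    simp [norm_smul, mul_pow]
  refine (hp.mul hi).congr_deriv ?_
  simp only [zero_smul, add_zero, inner_smul_right, real_inner_self_eq_norm_sq]
  have hpow : (‖x - x₀‖ ^ 2 + e) ^ (β - 1) =
      (‖x - x₀‖ ^ 2 + e) ^ (β - 2) * (‖x - x₀‖ ^ 2 + e) := by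
    rw [← Real.rpow_add_one (by positivity)]
    congr 1
    ring
  rw [show β - 1 - 1 = β - 2 by ring, hpow]
  ring

section Viscosity

variable {Ω : Set (EuclideanSpace ℝ (Fin n))} {Λ : ℝ} {v : EuclideanSpace ℝ (Fin n) → ℝ}
    {x₀ x : EuclideanSpace ℝ (Fin n)} {r : ℝ}

/-- Testing a supersolution at an interior minimum over a closed ball. -/
lemma IsInftySuper.of_min_closedBall (hv : IsInftySuper Ω Λ v) {φ : EuclideanSpace ℝ (Fin n) → ℝ}
    (hφ : ContDiff ℝ 2 φ) {z : EuclideanSpace ℝ (Fin n)} (hball : ball x₀ r ⊆ Ω)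
        (hz : z ∈ ball x₀ r)
    (hmin : ∀ y ∈ closedBall x₀ r, v z - φ z ≤ v y - φ y) :
    0 ≤ ‖gradient φ z‖ - Λ * Real.exp (v z) ∧ 0 ≤ -(hessQ φ z) := by
  refine hv z (hball hz) φ hφ (mem_nhdsWithin_of_mem_nhds ?_)
  filter_upwards [isOpen_ball.mem_nhds hz] with y hy using hmin y (ball_subset_closedBall hy)

/-- A supersolution grows at least with slope `Λ` away from the zero set. -/
lemma IsInftySuper.mul_radius_le (hv : IsInftySuper Ω Λ v) (hΛ : 0 < Λ)
    (hc : ContinuousOn v (closedBall x₀ r)) (h0 : ∀ y ∈ closedBall x₀ r, 0 ≤ v y)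
    (hr : 0 ≤ r) (hball : ball x₀ r ⊆ Ω) : Λ * r ≤ v x₀ := by
  have key : ∀ δ : ℝ, 0 < δ → Λ * r ≤ v x₀ + Λ * δ := fun δ hδ => by
    have he : 0 < δ ^ 2 := by positivity
    have hφ := radial_contDiff x₀ he (1 / 2) (-Λ)
    set φ : EuclideanSpace ℝ (Fin n) → ℝ := fun x => -Λ * (‖x - x₀‖ ^ 2 + δ ^ 2) ^ (1 / 2 :
        ℝ) with hφdef
    obtain ⟨z, hz, hmin⟩ := (isCompact_closedBall x₀ r).exists_isMinOn
      ⟨x₀, mem_closedBall_self hr⟩ (hc.sub hφ.continuous.continuousOn)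
    have hmin' : ∀ y ∈ closedBall x₀ r, v z - φ z ≤ v y - φ y := fun y hy => hmin hy
    have hx := hmin' x₀ (mem_closedBall_self hr)
    have hnz := h0 z hz
    by_cases hzb : z ∈ ball x₀ r
    · exfalso
      have h1 := (hv.of_min_closedBall hφ hball hzb hmin').1
      rw [gradient_radial x₀ he, norm_smul] at h1
      have hq : (0 : ℝ) < ‖z - x₀‖ ^ 2 + δ ^ 2 := by positivity
      have hp : (‖z - x₀‖ ^ 2 + δ ^ 2) ^ (1 / 2 - 1 : ℝ) =
          (√(‖z - x₀‖ ^ 2 + δ ^ 2))⁻¹ := by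
        rw [Real.sqrt_eq_rpow, ← Real.rpow_neg hq.le]
        norm_num
      have hs : ‖z - x₀‖ < √(‖z - x₀‖ ^ 2 + δ ^ 2) :=
        Real.lt_sqrt_of_sq_lt (by linarith)
      have hs0 : 0 < √(‖z - x₀‖ ^ 2 + δ ^ 2) := Real.sqrt_pos.2 hq
      have h2 : ‖2 * -Λ * (1 / 2) * (‖z - x₀‖ ^ 2 + δ ^ 2) ^ (1 / 2 - 1 : ℝ)‖ * ‖z - x₀‖ < Λ := by
        rw [hp, Real.norm_eq_abs, show 2 * -Λ * (1 / 2) * (√(‖z - x₀‖ ^ 2 + δ ^ 2))⁻¹ =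
          -(Λ * (√(‖z - x₀‖ ^ 2 + δ ^ 2))⁻¹) by ring, abs_neg, abs_of_pos (by positivity),
          mul_assoc]
        have : (√(‖z - x₀‖ ^ 2 + δ ^ 2))⁻¹ * ‖z - x₀‖ < 1 := by
          rw [inv_mul_lt_iff₀ hs0]; linarith
        nlinarith
      have h3 : Λ ≤ Λ * Real.exp (v z) := le_mul_of_one_le_right hΛ.le (Real.one_le_exp hnz)
      linarith
    · have hd : r ≤ ‖z - x₀‖ := by
        rw [mem_ball, dist_eq_norm] at hzb
        exact not_lt.1 hzb
      have h1 : r ≤ (‖z - x₀‖ ^ 2 + δ ^ 2) ^ (1 / 2 : ℝ) := by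
        rw [← Real.sqrt_eq_rpow]
        exact Real.le_sqrt_of_sq_le (by nlinarith)
      have h2 : φ x₀ = -Λ * δ := by
        simp only [hφdef, sub_self, norm_zero]
        rw [← Real.sqrt_eq_rpow]
        simp [Real.sqrt_sq hδ.le]
      have h3 : φ z ≤ -Λ * r := by
        simp only [hφdef]
        nlinarith
      linarith
  refine le_of_forall_pos_le_add fun ε hε => ?_
  have := key (ε / Λ) (by positivity)
  rwa [mul_div_cancel₀ _ hΛ.ne'] at this

lemma rpow_quarter_sq {a : ℝ} (ha : 0 ≤ a) : (a ^ 2) ^ (1 / 4 : ℝ) = √a := by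
  rw [Real.sqrt_eq_rpow, ← Real.rpow_natCast, ← Real.rpow_mul ha]
  norm_num

/-- A nonnegative supersolution lies above the `1/2`-Hölder cone with vertex at `x₀`. -/
lemma IsInftySuper.cone_le (hv : IsInftySuper Ω Λ v)
    (hc : ContinuousOn v (closedBall x₀ r)) (h0 : ∀ y ∈ closedBall x₀ r, 0 ≤ v y)
    (hr : 0 < r) (hball : ball x₀ r ⊆ Ω) (hx : x ∈ closedBall x₀ r) :
    v x₀ * (1 - √(‖x - x₀‖ / r)) ≤ v x := by
  have hx₀ : x₀ ∈ closedBall x₀ r := mem_closedBall_self hr.le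
  rcases (h0 x₀ hx₀).eq_or_lt with hz0 | hpos
  · rw [← hz0, zero_mul]
    exact h0 x hx
  by_contra! hlt
  set C : ℝ := v x₀ / √r with hC
  have hsr : 0 < √r := Real.sqrt_pos.2 hr
  have hCpos : 0 < C := div_pos hpos hsr
  have hCr : C * √r = v x₀ := div_mul_cancel₀ _ hsr.ne'
  have hlt' : v x + C * (‖x - x₀‖ ^ 2 + 0) ^ (1 / 4 : ℝ) < v x₀ := by
    rw [add_zero, rpow_quarter_sq (norm_nonneg _)]
    rw [Real.sqrt_div (norm_nonneg _)] at hlt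
    have : C * √‖x - x₀‖ = v x₀ * (√‖x - x₀‖ / √r) := by rw [hC]; ring
    linarith
  obtain ⟨m, hm1, hm2⟩ := exists_between hlt'
  obtain ⟨δ, hδ, hnear⟩ : ∃ δ > 0, ∀ y ∈ closedBall x₀ r, dist y x₀ < δ → m < v y := by
    have := (hc x₀ hx₀).eventually (lt_mem_nhds hm2)
    obtain ⟨δ, hδ, h⟩ := Metric.mem_nhdsWithin_iff.1 this
    exact ⟨δ, hδ, fun y hy hd => h ⟨hd, hy⟩⟩
  obtain ⟨e, he, hem, heδ⟩ : ∃ e > 0,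
      v x + C * (‖x - x₀‖ ^ 2 + e) ^ (1 / 4 : ℝ) < m ∧ 2 * e < δ ^ 2 := by
    have hcont : Continuous fun e : ℝ => v x + C * (‖x - x₀‖ ^ 2 + e) ^ (1 / 4 : ℝ) :=
      continuous_const.add (continuous_const.mul
        ((continuous_const.add continuous_id).rpow_const fun _ => Or.inr (by norm_num)))
    have h1 : ∀ᶠ e in 𝓝[>] (0 : ℝ), v x + C * (‖x - x₀‖ ^ 2 + e) ^ (1 / 4 : ℝ) < m :=
      nhdsWithin_le_nhds (hcont.continuousAt.eventually (gt_mem_nhds hm1))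
    have h2 : ∀ᶠ e in 𝓝[>] (0 : ℝ), 2 * e < δ ^ 2 := by
      refine nhdsWithin_le_nhds ((continuous_const.mul continuous_id).continuousAt.eventually
        (gt_mem_nhds ?_))
      simpa using pow_pos hδ 2
    obtain ⟨e, he1, he2, he3⟩ := (h1.and (h2.and self_mem_nhdsWithin)).exists
    exact ⟨e, he3, he1, he2⟩
  have hφ := radial_contDiff x₀ he (1 / 4) (-C)
  set φ : EuclideanSpace ℝ (Fin n) → ℝ := fun x => -C * (‖x - x₀‖ ^ 2 + e) ^ (1 / 4 : ℝ) with hφdef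
  obtain ⟨z, hz, hmin⟩ := (isCompact_closedBall x₀ r).exists_isMinOn ⟨x₀, hx₀⟩
    (hc.sub hφ.continuous.continuousOn)
  have hmin' : ∀ y ∈ closedBall x₀ r, v z - φ z ≤ v y - φ y := fun y hy => hmin hy
  have hzm : v z + C * (‖z - x₀‖ ^ 2 + e) ^ (1 / 4 : ℝ) < m := by
    have := hmin' x hx
    simp only [hφdef] at this
    linarith
  have hq : 0 < (‖z - x₀‖ ^ 2 + e) := by positivity
  have hpow : 0 < (‖z - x₀‖ ^ 2 + e) ^ (1 / 4 : ℝ) := Real.rpow_pos_of_pos hq _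
  have hfar : δ ≤ ‖z - x₀‖ := by
    by_contra! hlt
    have := hnear z hz (by rwa [dist_eq_norm])
    nlinarith
  have hzb : z ∈ ball x₀ r := by
    rw [mem_ball, dist_eq_norm]
    by_contra! hge
    have h1 : √r ≤ (‖z - x₀‖ ^ 2 + e) ^ (1 / 4 : ℝ) := by
      rw [← rpow_quarter_sq hr.le]
      exact Real.rpow_le_rpow (by positivity) (by nlinarith) (by norm_num)
    have h2 := h0 z hz
    nlinarith
  have h1 := (hv.of_min_closedBall hφ hball hzb hmin').2
  rw [hessQ_radial x₀ he] at h1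
  have hs : δ ^ 2 ≤ ‖z - x₀‖ ^ 2 := by gcongr
  have hs0 : 0 < ‖z - x₀‖ ^ 2 := lt_of_lt_of_le (by positivity) hs
  have hk : 0 < (2 * -C * (1 / 4) * (‖z - x₀‖ ^ 2 + e) ^ (1 / 4 - 1 : ℝ)) ^ 2 := by
    have := Real.rpow_pos_of_pos hq (1 / 4 - 1 : ℝ)
    have hne : 2 * -C * (1 / 4) * (‖z - x₀‖ ^ 2 + e) ^ (1 / 4 - 1 : ℝ) ≠ 0 :=
      mul_ne_zero (by linarith) this.ne'
    positivity
  have hp2 := Real.rpow_pos_of_pos hq (1 / 4 - 2 : ℝ)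
  have hlast : 0 < -((2 * (1 / 4 : ℝ) - 1) * ‖z - x₀‖ ^ 2 + e) := by linarith
  have := mul_pos (mul_pos (mul_pos (mul_pos (half_pos hCpos) hk) hs0) hp2) hlast
  nlinarith

lemma dist_scaled_supersolution (hΩo : IsOpen Ω) {K : ℝ} (hK : 0 < K)
    (hne : (frontier Ω).Nonempty)
    (hbound : ∀ y ∈ Ω, Λ * Real.exp (K * infDist y (frontier Ω)) ≤ K) :
    IsInftySuper Ω Λ fun y => K * infDist y (frontier Ω) := by
  intro z hz φ hφ hmin
  obtain ⟨y, hy, hdy⟩ := isClosed_frontier.exists_infDist_eq_dist hne z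
  have hzy : z ≠ y := by
    rintro rfl
    rw [hΩo.frontier_eq] at hy
    exact hy.2 hz
  have htouch : ∀ᶠ p in 𝓝 z, φ p ≤ φ z + K * (‖p - y‖ - ‖z - y‖) := by
    filter_upwards [hmin.isLocalMin (hΩo.mem_nhds hz)] with p hp
    have h1 : infDist p (frontier Ω) ≤ ‖p - y‖ := by
      rw [← dist_eq_norm]; exact infDist_le_dist_of_mem hy
    rw [hdy, dist_eq_norm] at hp
    nlinarith
  have hline : ∀ g : EuclideanSpace ℝ (Fin n), ∀ᶠ t in 𝓝 (0 : ℝ),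
      φ (z + t • g) ≤ φ z + K * (‖z + t • g - y‖ - ‖z - y‖) := fun g => by
    have hc : ContinuousAt (fun t : ℝ => z + t • g) 0 := by fun_prop
    have h' : ∀ᶠ p in 𝓝 (z + (0 : ℝ) • g), φ p ≤ φ z + K * (‖p - y‖ - ‖z - y‖) := by
      rw [zero_smul, add_zero]
      exact htouch
    exact hc.eventually h'
  set ν := z - y with hν
  have hνpos : 0 < ‖ν‖ := norm_pos_iff.2 (sub_ne_zero.2 hzy)
  have hdir : ∀ k : ℝ, 0 ≤ k → fderiv ℝ φ z (k • ν) = K * k * ‖ν‖ ∧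
      fderiv ℝ (fderiv ℝ φ) z (k • ν) (k • ν) ≤ 0 := fun k hk => by
    refine line_touching hφ ?_
    have hsmall : ∀ᶠ t in 𝓝 (0 : ℝ), 0 < 1 + t * k := by
      have hc : ContinuousAt (fun t : ℝ => 1 + t * k) 0 := by fun_prop
      exact hc.eventually (lt_mem_nhds (by simp))
    filter_upwards [hline (k • ν), hsmall] with t ht htk
    have : z + t • k • ν - y = (1 + t * k) • ν := by
      rw [add_smul, one_smul, mul_smul, hν]; abel
    rw [this, norm_smul, Real.norm_of_nonneg htk.le] at ht
    linarith
  have hgν : inner ℝ (gradient φ z) ν = K * ‖ν‖ := by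
    rw [inner_gradient_left]
    simpa using (hdir 1 zero_le_one).1
  have hgle : ‖gradient φ z‖ ≤ K := by
    by_contra! hgt
    set g := gradient φ z with hg
    have hgg : fderiv ℝ φ z g = ‖g‖ ^ 2 := by
      rw [← inner_gradient_left, ← hg, real_inner_self_eq_norm_sq]
    have hd : HasDerivAt (fun t : ℝ => φ (z + t • g)) (‖g‖ ^ 2) 0 := by
      have := hasDerivAt_line hφ z g 0
      rwa [zero_smul, add_zero, hgg] at this
    have hd2 : HasDerivAt (fun t : ℝ => φ (z + t • g) - K * ‖g‖ * t) (‖g‖ ^ 2 - K * ‖g‖) 0 := by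
      have := hd.sub ((hasDerivAt_id' (0 : ℝ)).const_mul (K * ‖g‖))
      rw [mul_one] at this
      exact this
    have hpos : 0 < ‖g‖ ^ 2 - K * ‖g‖ := by nlinarith
    have hslope := hd2.tendsto_slope_zero_right
    have h1 := hslope.eventually (lt_mem_nhds hpos)
    have h2 : ∀ᶠ t in 𝓝[>] (0 : ℝ), φ (z + t • g) ≤ φ z + K * (‖z + t • g - y‖ - ‖ν‖) :=
      nhdsWithin_le_nhds (hline g)
    obtain ⟨t, ht1, ht2, ht3⟩ := (h1.and (h2.and self_mem_nhdsWithin)).exists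
    have ht3' : (0 : ℝ) < t := ht3
    have ht4 : ‖z + t • g - y‖ ≤ ‖ν‖ + t * ‖g‖ := by
      have : z + t • g - y = ν + t • g := by rw [hν]; abel
      rw [this]
      refine (norm_add_le _ _).trans ?_
      rw [norm_smul, Real.norm_of_nonneg ht3'.le]
    simp only [zero_add, zero_smul, add_zero, mul_zero, sub_zero, smul_eq_mul] at ht1
    have ht5 := (pos_iff_pos_of_mul_pos ht1).1 (inv_pos.2 ht3')
    nlinarith
  have hgeq : gradient φ z = (K / ‖ν‖) • ν := by
    have : ‖gradient φ z - (K / ‖ν‖) • ν‖ ^ 2 ≤ 0 := by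
      rw [norm_sub_sq_real, inner_smul_right, hgν, norm_smul, Real.norm_of_nonneg (by positivity),
        div_mul_cancel₀ _ hνpos.ne', show K / ‖ν‖ * (K * ‖ν‖) = K * K by field_simp]
      nlinarith [norm_nonneg (gradient φ z)]
    have h0 : ‖gradient φ z - (K / ‖ν‖) • ν‖ = 0 := by
      nlinarith [norm_nonneg (gradient φ z - (K / ‖ν‖) • ν)]
    exact sub_eq_zero.1 (norm_eq_zero.1 h0)
  constructor
  · rw [hgeq, norm_smul, Real.norm_of_nonneg (by positivity), div_mul_cancel₀ _ hνpos.ne']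
    exact sub_nonneg.2 (hbound z hz)
  · rw [hessQ_eq, hgeq]
    exact neg_nonneg.2 (hdir (K / ‖ν‖) (by positivity)).2

/-- Continuous supersolutions vanishing on the boundary. -/
def zeroSupersolutions (Ω : Set (EuclideanSpace ℝ (Fin n))) (Λ : ℝ) :
    Set (EuclideanSpace ℝ (Fin n) → ℝ) :=
  {v | ContinuousOn v (closure Ω) ∧ (∀ x ∈ frontier Ω, v x = 0) ∧ IsInftySuper Ω Λ v}

/-- The pointwise infimum of the continuous supersolutions vanishing on the boundary. -/
noncomputable def perronInf (Ω : Set (EuclideanSpace ℝ (Fin n))) (Λ : ℝ)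
    (x : EuclideanSpace ℝ (Fin n)) : ℝ :=
  ⨅ v : zeroSupersolutions Ω Λ, v.1 x

lemma zeroSupersolutions_nonneg (hΩo : IsOpen Ω) (hΩb : Bornology.IsBounded Ω) (hΛ : 0 < Λ)
    (hv : v ∈ zeroSupersolutions Ω Λ) (hx : x ∈ closure Ω) : 0 ≤ v x := by
  obtain ⟨hc, hfr, hsup⟩ := hv
  obtain ⟨z, hz, hmin⟩ := hΩb.isCompact_closure.exists_isMinOn ⟨x, hx⟩ hc
  have hzx : v z ≤ v x := hmin hx
  by_cases hzΩ : z ∈ Ω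
  · have h := (hsup z hzΩ (fun _ => 0) contDiff_const (by
      filter_upwards [self_mem_nhdsWithin] with y hy
      simpa using hmin (subset_closure hy))).1
    rw [gradient_fun_const, norm_zero] at h
    have := mul_pos hΛ (Real.exp_pos (v z))
    linarith
  · rw [← hfr z (by rw [hΩo.frontier_eq]; exact ⟨hz, hzΩ⟩)]
    exact hzx

lemma perronInf_le (hΩo : IsOpen Ω) (hΩb : Bornology.IsBounded Ω) (hΛ : 0 < Λ)
    (hv : v ∈ zeroSupersolutions Ω Λ) (hx : x ∈ closure Ω) : perronInf Ω Λ x ≤ v x :=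
  ciInf_le (f := fun v : zeroSupersolutions Ω Λ => v.1 x)
    ⟨0, by rintro _ ⟨w, rfl⟩; exact zeroSupersolutions_nonneg hΩo hΩb hΛ w.2 hx⟩ ⟨v, hv⟩

lemma le_perronInf (hne : (zeroSupersolutions Ω Λ).Nonempty) {a : ℝ}
    (h : ∀ v ∈ zeroSupersolutions Ω Λ, a ≤ v x) : a ≤ perronInf Ω Λ x :=
  haveI := hne.to_subtype
  le_ciInf fun v => h v.1 v.2

lemma exists_lt_of_perronInf_lt (hne : (zeroSupersolutions Ω Λ).Nonempty) {a : ℝ}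
    (h : perronInf Ω Λ x < a) : ∃ v ∈ zeroSupersolutions Ω Λ, v x < a := by
  by_contra! hcon
  exact absurd (le_perronInf hne hcon) (not_le.2 h)

lemma closedBall_subset_closure (hr : 0 < r) (hball : ball x₀ r ⊆ Ω) :
    closedBall x₀ r ⊆ closure Ω := by
  rw [← closure_ball x₀ hr.ne']
  exact closure_mono hball

lemma perronInf_cone_le (hΩo : IsOpen Ω) (hΩb : Bornology.IsBounded Ω) (hΛ : 0 < Λ)
    (hne : (zeroSupersolutions Ω Λ).Nonempty) (hr : 0 < r) (hball : ball x₀ r ⊆ Ω)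
    (hx : x ∈ closedBall x₀ r) :
    perronInf Ω Λ x₀ * (1 - √(‖x - x₀‖ / r)) ≤ perronInf Ω Λ x := by
  have hcl := closedBall_subset_closure hr hball
  refine le_perronInf hne fun v hv => ?_
  refine le_trans ?_ (hv.2.2.cone_le (hv.1.mono hcl)
    (fun y hy => zeroSupersolutions_nonneg hΩo hΩb hΛ hv (hcl hy)) hr hball hx)
  refine mul_le_mul_of_nonneg_right
    (perronInf_le hΩo hΩb hΛ hv (hcl (mem_closedBall_self hr.le))) ?_
  rw [sub_nonneg, Real.sqrt_le_one, div_le_one hr, ← dist_eq_norm]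
  exact hx

lemma perronInf_continuousAt (hΩo : IsOpen Ω) (hΩb : Bornology.IsBounded Ω) (hΛ : 0 < Λ)
    (hne : (zeroSupersolutions Ω Λ).Nonempty) (hx₀ : x₀ ∈ Ω) :
    ContinuousAt (perronInf Ω Λ) x₀ := by
  obtain ⟨R, hR, hRΩ⟩ := Metric.isOpen_iff.1 hΩo x₀ hx₀
  set r := R / 2 with hrdef
  have hr : 0 < r := half_pos hR
  have hcont : Continuous fun x : EuclideanSpace ℝ (Fin n) => 1 - √(‖x - x₀‖ / r) := by fun_prop
  have hlim : Tendsto (fun x : EuclideanSpace ℝ (Fin n) => 1 - √(‖x - x₀‖ / r)) (𝓝 x₀) (𝓝 1) := by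
    have := hcont.tendsto x₀
    simpa using this
  have hlow : Tendsto (fun x => perronInf Ω Λ x₀ * (1 - √(‖x - x₀‖ / r))) (𝓝 x₀)
      (𝓝 (perronInf Ω Λ x₀)) := by
    simpa using hlim.const_mul (perronInf Ω Λ x₀)
  have hup : Tendsto (fun x => perronInf Ω Λ x₀ / (1 - √(‖x - x₀‖ / r))) (𝓝 x₀)
      (𝓝 (perronInf Ω Λ x₀)) := by
    have := (tendsto_const_nhds (x := perronInf Ω Λ x₀)).div hlim one_ne_zero
    rwa [div_one] at this
  refine tendsto_of_tendsto_of_tendsto_of_le_of_le' hlow hup ?_ ?_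
  · filter_upwards [ball_mem_nhds x₀ hr] with x hx
    exact perronInf_cone_le hΩo hΩb hΛ hne hr
      ((ball_subset_ball (by linarith)).trans hRΩ) (ball_subset_closedBall hx)
  · filter_upwards [ball_mem_nhds x₀ hr, hlim.eventually (lt_mem_nhds one_pos)] with x hx hpos
    rw [le_div_iff₀ hpos]
    have hsub : ball x r ⊆ Ω := fun y hy => hRΩ (by
      have := dist_triangle y x x₀
      rw [mem_ball] at hx hy ⊢
      linarith)
    have := perronInf_cone_le hΩo hΩb hΛ hne hr hsub (x := x₀)
      (by rw [mem_closedBall, dist_comm]; exact (mem_ball.1 hx).le)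
    rwa [norm_sub_rev] at this

lemma perronInf_isInftySuper (hΩo : IsOpen Ω) (hΩb : Bornology.IsBounded Ω) (hΛ : 0 < Λ)
    (hne : (zeroSupersolutions Ω Λ).Nonempty) : IsInftySuper Ω Λ (perronInf Ω Λ) := by
  intro x₀ hx₀ φ hφ hmin
  set u := perronInf Ω Λ
  have huc : ContinuousAt u x₀ := perronInf_continuousAt hΩo hΩb hΛ hne hx₀
  have hφ' : ContDiff ℝ 2 fun x => φ x + -1 * (‖x - x₀‖ ^ 2) ^ 2 :=
    hφ.add (contDiff_const.mul (quartic_contDiff x₀))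
  obtain ⟨hg, hh⟩ := quartic_perturbation hφ x₀ (-1)
  set ψ : EuclideanSpace ℝ (Fin n) → ℝ := fun x => φ x + -1 * (‖x - x₀‖ ^ 2) ^ 2 with hψ
  have hfreq : ∃ᶠ z in 𝓝 x₀, 0 ≤ ‖gradient ψ z‖ - Λ * Real.exp (u z) ∧ 0 ≤ -(hessQ ψ z) := by
    rw [Metric.nhds_basis_ball.frequently_iff]
    intro ρ' hρ'
    obtain ⟨ρ'', hρ'', hsub⟩ := Metric.eventually_nhds_iff_ball.1
      ((hmin.isLocalMin (hΩo.mem_nhds hx₀)).and (hΩo.mem_nhds hx₀))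
    obtain ⟨ρ, hρ, hρlt⟩ := exists_between (lt_min hρ' hρ'')
    have hclosed : closedBall x₀ ρ ⊆ ball x₀ ρ'' :=
      closedBall_subset_ball (hρlt.trans_le (min_le_right _ _))
    have hballΩ : ball x₀ ρ ⊆ Ω := fun y hy => (hsub y (hclosed (ball_subset_closedBall hy))).2
    have hclΩ : closedBall x₀ ρ ⊆ closure Ω := fun y hy => subset_closure (hsub y (hclosed hy)).2
    have hρ4 : 0 < ρ ^ 4 := by positivity
    obtain ⟨v, hv, hvlt⟩ := exists_lt_of_perronInf_lt hne
      (show perronInf Ω Λ x₀ < u x₀ + ρ ^ 4 by linarith)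
    have hx₀mem : x₀ ∈ closedBall x₀ ρ := mem_closedBall_self hρ.le
    obtain ⟨z, hz, hzmin⟩ := (isCompact_closedBall x₀ ρ).exists_isMinOn ⟨x₀, hx₀mem⟩
      ((hv.1.mono hclΩ).sub hφ'.continuous.continuousOn)
    have hzmin' : ∀ y ∈ closedBall x₀ ρ, v z - ψ z ≤ v y - ψ y := fun y hy => hzmin hy
    have huv : u z ≤ v z := perronInf_le hΩo hΩb hΛ hv (hclΩ hz)
    have hzb : z ∈ ball x₀ ρ := by
      rw [mem_ball, dist_eq_norm]
      by_contra! hge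
      have h1 := hzmin' x₀ hx₀mem
      have h2 : u x₀ - φ x₀ ≤ u z - φ z := (hsub z (hclosed hz)).1
      have h3 : ρ ^ 4 ≤ (‖z - x₀‖ ^ 2) ^ 2 := by
        rw [← pow_mul]
        gcongr
      simp only [hψ, sub_self, norm_zero] at h1
      norm_num at h1
      linarith
    obtain ⟨ha, hb⟩ := hv.2.2.of_min_closedBall hφ' hballΩ hzb hzmin'
    refine ⟨z, ball_subset_ball (hρlt.le.trans (min_le_left _ _)) hzb, ?_, hb⟩
    have : Λ * Real.exp (u z) ≤ Λ * Real.exp (v z) := by gcongr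
    linarith
  have hc1 : ContinuousAt (fun z => ‖gradient ψ z‖ - Λ * Real.exp (u z)) x₀ :=
    (continuous_norm_gradient hφ').continuousAt.sub (huc.rexp.const_mul Λ)
  have hc2 : ContinuousAt (fun z => -(hessQ ψ z)) x₀ := (continuous_hessQ hφ').continuousAt.neg
  rw [← hg, ← hh]
  constructor
  · by_contra! hlt
    exact hfreq ((hc1.eventually (gt_mem_nhds hlt)).mono fun z hz h => absurd h.1 (not_le.2 hz))
  · by_contra! hlt
    exact hfreq ((hc2.eventually (gt_mem_nhds hlt)).mono fun z hz h => absurd h.2 (not_le.2 hz))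

/-- Lowering a supersolution by a strict classical supersolution inside a ball. -/
lemma IsInftySuper.bump (hv : IsInftySuper Ω Λ v) (hΩo : IsOpen Ω)
    {ψ : EuclideanSpace ℝ (Fin n) → ℝ} (hψ : ContDiff ℝ 2 ψ)
    (hstrict : ∀ z ∈ ball x₀ r, Λ * Real.exp (ψ z) ≤ ‖gradient ψ z‖ ∧ hessQ ψ z ≤ 0)
    {w : EuclideanSpace ℝ (Fin n) → ℝ} (hin : ∀ z ∈ ball x₀ r, w z = min (v z) (ψ z))
    (hout : ∀ z ∉ ball x₀ r, w z = v z) : IsInftySuper Ω Λ w := by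
  intro z hz φ hφ hmin
  have hle : ∀ y, w y ≤ v y := fun y => by
    by_cases hy : y ∈ ball x₀ r
    · rw [hin y hy]; exact min_le_left _ _
    · exact (hout y hy).le
  by_cases heq : w z = v z
  · rw [heq]
    refine hv z hz φ hφ ?_
    filter_upwards [hmin] with y hy
    have := hle y
    simp only [heq] at hy
    linarith
  · have hzb : z ∈ ball x₀ r := by
      by_contra hzb
      exact heq (hout z hzb)
    have hwψ : w z = ψ z := by
      rcases min_choice (v z) (ψ z) with h | h
      · exact absurd ((hin z hzb).trans h) heq
      · exact (hin z hzb).trans h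
    have hloc : IsLocalMin (fun y => ψ y - φ y) z := by
      filter_upwards [hmin.isLocalMin (hΩo.mem_nhds hz), isOpen_ball.mem_nhds hzb] with y hy hyb
      have : w y ≤ ψ y := (hin y hyb).le.trans (min_le_right _ _)
      simp only [hwψ] at hy
      linarith
    obtain ⟨h1, h2⟩ := touching_comparison hφ hψ hloc
    obtain ⟨h3, h4⟩ := hstrict z hzb
    rw [h1, hwψ]
    exact ⟨sub_nonneg.2 h3, neg_nonneg.2 (h2.trans h4)⟩

lemma perronInf_isInftySub (hΩo : IsOpen Ω) (hΩb : Bornology.IsBounded Ω) (hΛ : 0 < Λ)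
    (hmem : perronInf Ω Λ ∈ zeroSupersolutions Ω Λ) : IsInftySub Ω Λ (perronInf Ω Λ) := by
  intro x₀ hx₀ φ hφ hmax
  by_contra! hcon
  obtain ⟨hcon1, hcon2⟩ := lt_min_iff.1 hcon
  set u := perronInf Ω Λ
  have hφ' : ContDiff ℝ 2 fun x => φ x + 1 * (‖x - x₀‖ ^ 2) ^ 2 :=
    hφ.add (contDiff_const.mul (quartic_contDiff x₀))
  obtain ⟨hg, hh⟩ := quartic_perturbation hφ x₀ 1
  set ψ : EuclideanSpace ℝ (Fin n) → ℝ := fun x => φ x + 1 * (‖x - x₀‖ ^ 2) ^ 2 with hψ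
  set c := u x₀ - φ x₀ with hc
  have hev : ∀ᶠ z in 𝓝 x₀, Λ * Real.exp (ψ z + c) < ‖gradient ψ z‖ ∧ 0 < -(hessQ ψ z) := by
    have hc1 : ContinuousAt (fun z => ‖gradient ψ z‖ - Λ * Real.exp (ψ z + c)) x₀ :=
      ((continuous_norm_gradient hφ').sub
        (continuous_const.mul (hφ'.continuous.add continuous_const).rexp)).continuousAt
    have hc2 : ContinuousAt (fun z => -(hessQ ψ z)) x₀ := (continuous_hessQ hφ').continuousAt.neg
    have hval : ψ x₀ + c = u x₀ := by simp [hψ, hc]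
    have e1 := hc1.eventually (lt_mem_nhds (a := 0) (by beta_reduce; rw [hval, hg]; exact hcon1))
    have e2 := hc2.eventually (lt_mem_nhds (a := 0) (by beta_reduce; rw [hh]; exact hcon2))
    filter_upwards [e1, e2] with z h1 h2 using ⟨sub_pos.1 h1, h2⟩
  obtain ⟨ρ', hρ', hsub⟩ := Metric.eventually_nhds_iff_ball.1
    (hev.and ((hmax.isLocalMax (hΩo.mem_nhds hx₀)).and (hΩo.mem_nhds hx₀)))
  obtain ⟨ρ, hρ, hρlt⟩ := exists_between hρ'
  have hcb : closedBall x₀ ρ ⊆ ball x₀ ρ' := closedBall_subset_ball hρlt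
  set δ := ρ ^ 4 / 2 with hδ
  have hδpos : 0 < δ := by positivity
  set χ : EuclideanSpace ℝ (Fin n) → ℝ := fun x => ψ x + (c - δ) with hχ
  have hχd : ContDiff ℝ 2 χ := hφ'.add contDiff_const
  have hfχ : fderiv ℝ χ = fderiv ℝ ψ := funext fun z => fderiv_add_const (c - δ)
  have hgχ : gradient χ = gradient ψ := funext fun z => by simp only [gradient, hfχ]
  have hhχ : hessQ χ = hessQ ψ := funext fun z => by rw [hessQ_eq, hessQ_eq, hfχ, hgχ]
  classical
  set w : EuclideanSpace ℝ (Fin n) → ℝ :=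
    fun x => if x ∈ ball x₀ ρ then min (u x) (χ x) else u x
  have hin : ∀ z ∈ ball x₀ ρ, w z = min (u z) (χ z) := fun z hz => if_pos hz
  have hout : ∀ z ∉ ball x₀ ρ, w z = u z := fun z hz => if_neg hz
  have hsuper : IsInftySuper Ω Λ w := by
    refine hmem.2.2.bump hΩo hχd (fun z hz => ?_) hin hout
    obtain ⟨⟨h1, h2⟩, -⟩ := hsub z (hcb (ball_subset_closedBall hz))
    rw [hgχ, hhχ]
    refine ⟨le_trans ?_ h1.le, by linarith⟩
    have : χ z ≤ ψ z + c := by simp only [hχ]; linarith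
    gcongr
  have hballΩ : ∀ z ∈ closedBall x₀ ρ, z ∈ Ω := fun z hz => (hsub z (hcb hz)).2.2
  have hcont : ContinuousOn w (closure Ω) := by
    have h1 : ContinuousOn w (closure Ω ∩ closedBall x₀ ρ) := by
      refine ((hmem.1.mono inter_subset_left).inf hχd.continuous.continuousOn).congr ?_
      intro z hz
      by_cases hzb : z ∈ ball x₀ ρ
      · exact hin z hzb
      · rw [hout z hzb]
        refine (min_eq_left ?_).symm
        have h2 : u z - φ z ≤ c := (hsub z (hcb hz.2)).2.1
        have h3 : ρ ^ 4 ≤ (‖z - x₀‖ ^ 2) ^ 2 := by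
          rw [← pow_mul]
          rw [mem_ball, dist_eq_norm, not_lt] at hzb
          gcongr
        simp only [hχ, hψ]
        linarith
    have h2 : ContinuousOn w (closure Ω ∩ (ball x₀ ρ)ᶜ) :=
      (hmem.1.mono inter_subset_left).congr fun z hz => hout z hz.2
    refine (h1.union_of_isClosed h2 (isClosed_closure.inter isClosed_closedBall)
      (isClosed_closure.inter isOpen_ball.isClosed_compl)).mono fun z hz => ?_
    by_cases hzb : z ∈ ball x₀ ρ
    · exact Or.inl ⟨hz, ball_subset_closedBall hzb⟩
    · exact Or.inr ⟨hz, hzb⟩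
  have hfr : ∀ z ∈ frontier Ω, w z = 0 := fun z hz => by
    rw [hout z, hmem.2.1 z hz]
    intro hzb
    rw [hΩo.frontier_eq] at hz
    exact hz.2 (hballΩ z (ball_subset_closedBall hzb))
  have hle : u x₀ ≤ w x₀ := perronInf_le hΩo hΩb hΛ ⟨hcont, hfr, hsuper⟩ (subset_closure hx₀)
  rw [hin x₀ (mem_ball_self hρ)] at hle
  have h1 := hle.trans (min_le_right _ _)
  simp only [hχ, hψ, hc, sub_self, norm_zero] at h1
  norm_num at h1
  linarith

end Viscosity

end Euclidean

/-- For every `0 < Λ ≤ Λ_max = 1/(e·R_Ω)` the limit problem has a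
minimal solution `u_Λ`, which satisfies
`Λ·dist(x,∂Ω) ≤ u_Λ(x) ≤ eΛ·dist(x,∂Ω)`. -/
theorem existence_minimal_solution {n : ℕ} (Ω : Set (EuclideanSpace ℝ (Fin n)))
    (hΩo : IsOpen Ω) (hΩb : Bornology.IsBounded Ω)
    (RΩ : ℝ) (hR : RΩ = sSup ((fun x => infDist x (frontier Ω)) '' Ω))
    (Λ : ℝ) (hΛ : 0 < Λ) (hΛmax : Λ ≤ 1 / (Real.exp 1 * RΩ)) :
    ∃ uΛ : EuclideanSpace ℝ (Fin n) → ℝ,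
      ContinuousOn uΛ (closure Ω) ∧ (∀ x ∈ frontier Ω, uΛ x = 0) ∧
      IsInftySol Ω Λ uΛ ∧
      (∀ x ∈ closure Ω,
        Λ * infDist x (frontier Ω) ≤ uΛ x ∧
        uΛ x ≤ Real.exp 1 * Λ * infDist x (frontier Ω)) ∧
      (∀ u : EuclideanSpace ℝ (Fin n) → ℝ,
        ContinuousOn u (closure Ω) → (∀ x ∈ frontier Ω, u x = 0) →
        IsInftySol Ω Λ u → ∀ x ∈ closure Ω, uΛ x ≤ u x) := by
  have hRpos : 0 < RΩ := by
    by_contra! hle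
    have : 1 / (Real.exp 1 * RΩ) ≤ 0 :=
      div_nonpos_of_nonneg_of_nonpos zero_le_one
        (mul_nonpos_of_nonneg_of_nonpos (Real.exp_pos 1).le hle)
    linarith
  have hΩne : Ω.Nonempty := by
    by_contra! hempty
    rw [hempty] at hR
    simp at hR
    exact hRpos.ne' hR
  have hfne : (frontier Ω).Nonempty := by
    by_contra! hempty
    rw [hempty] at hR
    simp [infDist_empty, hΩne] at hR
    exact hRpos.ne' hR
  have hdle : ∀ x ∈ Ω, infDist x (frontier Ω) ≤ RΩ := fun x hx => by
    rw [hR]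
    refine le_csSup ?_ (mem_image_of_mem _ hx)
    exact ((hΩb.isCompact_closure.image (continuous_infDist_pt (frontier Ω))).bddAbove).mono
      (image_mono subset_closure)
  have hK : 0 < Real.exp 1 * Λ := by positivity
  have hd0 : ∀ x ∈ frontier Ω, infDist x (frontier Ω) = 0 := fun x hx => infDist_zero_of_mem hx
  have hbarrier : (fun y => Real.exp 1 * Λ * infDist y (frontier Ω)) ∈
      zeroSupersolutions Ω Λ := by
    refine ⟨(continuous_const.mul (continuous_infDist_pt _)).continuousOn,
      fun x hx => by beta_reduce; rw [hd0 x hx, mul_zero],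
      dist_scaled_supersolution hΩo hK hfne fun y hy => ?_⟩
    have h1 : Real.exp 1 * Λ * infDist y (frontier Ω) ≤ 1 := by
      have h2 : Λ * (Real.exp 1 * RΩ) ≤ 1 := (le_div_iff₀ (by positivity)).1 hΛmax
      have h3 := mul_le_mul_of_nonneg_left (hdle y hy) hK.le
      linarith
    rw [mul_comm (Real.exp 1) Λ] at h1 ⊢
    gcongr
  have hne : (zeroSupersolutions Ω Λ).Nonempty := ⟨_, hbarrier⟩
  have hupper : ∀ x ∈ closure Ω,
      perronInf Ω Λ x ≤ Real.exp 1 * Λ * infDist x (frontier Ω) := fun x hx =>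
    perronInf_le hΩo hΩb hΛ hbarrier hx
  have hball : ∀ x ∈ Ω, ball x (infDist x (frontier Ω)) ⊆ Ω := fun x hx => by
    have huniv : Ω ≠ univ := by
      rintro rfl
      simp at hfne
    obtain ⟨y, hy, hxy⟩ := exists_mem_frontier_infDist_compl_eq_dist hx huniv
    exact (ball_subset_ball ((infDist_le_dist_of_mem hy).trans_eq hxy.symm)).trans
      ball_infDist_compl_subset
  have hzero : ∀ x ∈ frontier Ω, perronInf Ω Λ x = 0 := fun x hx => by
    have hxc := frontier_subset_closure hx
    refine le_antisymm ?_ (le_perronInf hne fun v hv => (hv.2.1 x hx).ge)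
    simpa [hd0 x hx] using hupper x hxc
  have hlower : ∀ x ∈ closure Ω, Λ * infDist x (frontier Ω) ≤ perronInf Ω Λ x := fun x hx => by
    by_cases hxΩ : x ∈ Ω
    · refine le_perronInf hne fun v hv => ?_
      have hpos : 0 < infDist x (frontier Ω) :=
        (isClosed_frontier.notMem_iff_infDist_pos hfne).1 fun h => by
          rw [hΩo.frontier_eq] at h
          exact h.2 hxΩ
      have hcl := closedBall_subset_closure hpos (hball x hxΩ)
      exact hv.2.2.mul_radius_le hΛ (hv.1.mono hcl)
        (fun y hy => zeroSupersolutions_nonneg hΩo hΩb hΛ hv (hcl hy)) hpos.le (hball x hxΩ)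
    · have hxf : x ∈ frontier Ω := by
        rw [hΩo.frontier_eq]
        exact ⟨hx, hxΩ⟩
      rw [hzero x hxf, hd0 x hxf, mul_zero]
  have hcont : ContinuousOn (perronInf Ω Λ) (closure Ω) := fun x hx => by
    by_cases hxΩ : x ∈ Ω
    · exact (perronInf_continuousAt hΩo hΩb hΛ hne hxΩ).continuousWithinAt
    · have hxf : x ∈ frontier Ω := by
        rw [hΩo.frontier_eq]
        exact ⟨hx, hxΩ⟩
      have hlim : ∀ c : ℝ, Tendsto (fun y => c * infDist y (frontier Ω)) (𝓝[closure Ω] x)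
          (𝓝 (perronInf Ω Λ x)) := fun c => by
        have := ((continuous_infDist_pt (frontier Ω)).tendsto x).const_mul c
        rw [hd0 x hxf, mul_zero, ← hzero x hxf] at this
        exact this.mono_left nhdsWithin_le_nhds
      refine tendsto_of_tendsto_of_tendsto_of_le_of_le' (hlim Λ) (hlim (Real.exp 1 * Λ)) ?_ ?_
      · filter_upwards [self_mem_nhdsWithin] with y hy using hlower y hy
      · filter_upwards [self_mem_nhdsWithin] with y hy using hupper y hy
  have hsuper := perronInf_isInftySuper hΩo hΩb hΛ hne
  exact ⟨perronInf Ω Λ, hcont, hzero,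
    ⟨hsuper, perronInf_isInftySub hΩo hΩb hΛ ⟨hcont, hzero, hsuper⟩⟩,
    fun x hx => ⟨hlower x hx, hupper x hx⟩,
    fun u huc hu0 hu x hx => perronInf_le hΩo hΩb hΛ ⟨huc, hu0, hu.1⟩ hx⟩
end

section
/- Let Ω ⊆ ℝⁿ be a bounded open set, R_Ω := sup_{x ∈ Ω} dist(x, ∂Ω), and Λ_max := 1/(e · R_Ω). Let 0 < Λ < Υ < Λ_max, and let u_Λ and u_Υ be continuous viscosity solutions of min{|∇u| − Λ e^{u}, −Δ_∞ u} = 0 and min{|∇u| − Υ e^{u}, −Δ_∞ u} = 0 in Ω respectively, both vanishing on ∂Ω, with sup |u_Λ| < 1 and sup |u_Υ| < 1. Then u_Λ ≤ u_Υ on closure(Ω). -/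
open Real Set Metric Filter Topology

theorem exists_contDiff_eventuallyEq {E : Type*} [NormedAddCommGroup E]
    [InnerProductSpace ℝ E] {f : E → ℝ} {w : E} {k : ℕ} (hf : ContDiffAt ℝ k f w) :
    ∃ φ : E → ℝ, ContDiff ℝ k φ ∧ φ =ᶠ[𝓝 w] f := by
  obtain ⟨ρ, hρ, hball⟩ := Metric.eventually_nhds_iff.1 (hf.eventually (by simp))
  let χ : ContDiffBump w := ⟨ρ / 4, ρ / 2, by linarith, by linarith⟩
  refine ⟨fun y => χ y * f y, contDiff_iff_contDiffAt.2 fun y => ?_, ?_⟩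
  · rcases lt_or_ge (dist y w) ρ with hy | hy
    · exact χ.contDiffAt.mul (hball hy)
    · refine (contDiffAt_const (c := (0 : ℝ))).congr_of_eventuallyEq ?_
      have : ∀ᶠ z in 𝓝 y, ρ / 2 < dist z w :=
        (continuous_id.dist continuous_const).continuousAt.eventually
          (lt_mem_nhds (by simp only [id]; linarith))
      filter_upwards [this] with z hz
      simp [χ.zero_of_le_dist hz.le]
  · filter_upwards [χ.eventuallyEq_one] with y hy
    simp [hy]

section Radial

variable {E : Type*} [NormedAddCommGroup E] [InnerProductSpace ℝ E]

theorem hasFDerivAt_norm_sub {x y : E} (hy : y ≠ x) :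
    HasFDerivAt (fun z => ‖z - x‖) (‖y - x‖⁻¹ • innerSL ℝ (y - x)) y := by
  have hpos : 0 < ‖y - x‖ := norm_pos_iff.2 (sub_ne_zero.2 hy)
  have h := (((hasFDerivAt_id y).sub_const x).norm_sq).sqrt (by simp only [id]; positivity)
  simp only [id, Real.sqrt_sq (norm_nonneg _)] at h
  refine h.congr_fderiv ?_
  ext p
  simp
  field_simp

theorem hasFDerivAt_radial {x y : E} (hy : y ≠ x) (a b : ℝ) :
    HasFDerivAt (fun z => a * ‖z - x‖ + b * ‖z - x‖ ^ 2)
      ((a * ‖y - x‖⁻¹ + 2 * b) • innerSL ℝ (y - x)) y := by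
  have h := ((hasFDerivAt_norm_sub hy).const_mul a).add
    ((((hasFDerivAt_id y).sub_const x).norm_sq).const_mul b)
  refine h.congr_fderiv ?_
  ext p
  simp
  ring

theorem fderiv_fderiv_radial_apply {x w : E} (hw : w ≠ x) (a b k : ℝ)
    (hk : k = a * ‖w - x‖⁻¹ + 2 * b) :
    fderiv ℝ (fderiv ℝ (fun z => a * ‖z - x‖ + b * ‖z - x‖ ^ 2)) w (k • (w - x)) (k • (w - x)) =
      2 * b * (a + 2 * b * ‖w - x‖) ^ 2 := by
  have hpos : 0 < ‖w - x‖ := norm_pos_iff.2 (sub_ne_zero.2 hw)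
  have hev : fderiv ℝ (fun z => a * ‖z - x‖ + b * ‖z - x‖ ^ 2) =ᶠ[𝓝 w]
      fun y => (a * ‖y - x‖⁻¹ + 2 * b) • innerSL ℝ (y - x) := by
    filter_upwards [isOpen_ne.mem_nhds hw] with y hy
    exact (hasFDerivAt_radial hy a b).fderiv
  have hinv : HasFDerivAt (fun y => a * ‖y - x‖⁻¹ + 2 * b)
      (a • (-(‖w - x‖ ^ 2)⁻¹) • (‖w - x‖⁻¹ • innerSL ℝ (w - x))) w :=
    (((hasDerivAt_inv hpos.ne').comp_hasFDerivAt w (hasFDerivAt_norm_sub hw)).const_mul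
      a).add_const _
  have hlin : HasFDerivAt (fun y => innerSL ℝ (y - x)) (innerSL ℝ : E →L[ℝ] E →L[ℝ] ℝ) w :=
    (innerSL ℝ).hasFDerivAt.comp w ((hasFDerivAt_id w).sub_const x)
  rw [hev.fderiv_eq, HasFDerivAt.fderiv (f := fun y => (a * ‖y - x‖⁻¹ + 2 * b) • innerSL ℝ (y - x))
    (hinv.smul hlin)]
  clear hinv hlin hev
  generalize w - x = d at *
  have hd : innerSL ℝ d d = ‖d‖ ^ 2 := real_inner_self_eq_norm_sq d
  simp [hk, hd]
  field_simp
  ring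

end Radial

theorem exists_radial_test {n : ℕ} {x w : EuclideanSpace ℝ (Fin n)} (hw : w ≠ x) (a b : ℝ) :
    ∃ φ : EuclideanSpace ℝ (Fin n) → ℝ, ContDiff ℝ 2 φ ∧
      φ =ᶠ[𝓝 w] (fun z => a * ‖z - x‖ + b * ‖z - x‖ ^ 2) ∧
      ‖gradient φ w‖ = |a + 2 * b * ‖w - x‖| ∧
      hessQ φ w = 2 * b * (a + 2 * b * ‖w - x‖) ^ 2 := by
  have hpos : 0 < ‖w - x‖ := norm_pos_iff.2 (sub_ne_zero.2 hw)
  have hcd : ContDiffAt ℝ (2 : ℕ) (fun z => a * ‖z - x‖ + b * ‖z - x‖ ^ 2) w := by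
    have h : ContDiffAt ℝ (2 : ℕ) (fun z : EuclideanSpace ℝ (Fin n) => ‖z - x‖) w :=
      (contDiffAt_id.sub contDiffAt_const).norm ℝ (sub_ne_zero.2 hw)
    exact (contDiffAt_const.mul h).add (contDiffAt_const.mul (h.pow 2))
  obtain ⟨φ, hφ, heq⟩ := exists_contDiff_eventuallyEq hcd
  have hgrad : gradient φ w = (a * ‖w - x‖⁻¹ + 2 * b) • (w - x) := by
    rw [heq.gradient_eq]
    refine HasGradientAt.gradient (hasGradientAt_iff_hasFDerivAt.2 ?_)
    refine (hasFDerivAt_radial hw a b).congr_fderiv ?_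
    ext p
    simp
  refine ⟨φ, hφ, heq, ?_, ?_⟩
  · rw [hgrad, norm_smul, Real.norm_eq_abs, ← abs_of_pos hpos, ← abs_mul, abs_of_pos hpos]
    congr 1
    field_simp
  · rw [hessQ, iteratedFDeriv_two_apply, hgrad]
    simp only [Matrix.cons_val_zero, Matrix.cons_val_one]
    rw [(heq.fderiv (𝕜 := ℝ)).fderiv_eq]
    exact fderiv_fderiv_radial_apply hw a b _ rfl

/-- Comparison with cones from below for viscosity supersolutions. -/
theorem IsInftySuper.cone_le_s10 {n : ℕ} {Ω : Set (EuclideanSpace ℝ (Fin n))} {Υ : ℝ}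
    {u : EuclideanSpace ℝ (Fin n) → ℝ} (hu : IsInftySuper Ω Υ u) {x : EuclideanSpace ℝ (Fin n)}
    {r m : ℝ} (hr : 0 < r) (hsub : closedBall x r ⊆ Ω) (hcont : ContinuousOn u (closedBall x r))
    (hm : ∀ y ∈ closedBall x r, m ≤ u y) :
    ∀ y ∈ closedBall x r, u x - (u x - m) / r * ‖y - x‖ ≤ u y := by
  intro y hy
  by_contra! hlt
  have hx : x ∈ closedBall x r := mem_closedBall_self hr.le
  set L := (u x - m) / r with hL
  have hLr : L * r = u x - m := by rw [hL]; field_simp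
  have hL0 : 0 ≤ L := div_nonneg (sub_nonneg.2 (hm x hx)) hr.le
  obtain ⟨γ, hγ, hγr⟩ : ∃ γ > 0, u y + L * ‖y - x‖ + 2 * γ * r * r < u x := by
    refine ⟨(u x - (u y + L * ‖y - x‖)) / (4 * r * r), by apply div_pos <;> nlinarith, ?_⟩
    field_simp
    linarith
  set f : EuclideanSpace ℝ (Fin n) → ℝ :=
    fun q => u q + ((L + 2 * γ * r) * ‖q - x‖ + (-γ) * ‖q - x‖ ^ 2) with hf
  have hfc : ContinuousOn f (closedBall x r) := hcont.add (by fun_prop)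
  obtain ⟨w, hw, hmin⟩ := (isCompact_closedBall x r).exists_isMinOn ⟨x, hx⟩ hfc
  have hyr : ‖y - x‖ ≤ r := by simpa [dist_eq_norm] using hy
  have hwr : ‖w - x‖ ≤ r := by simpa [dist_eq_norm] using hw
  have hfw : f w < u x := by
    refine (hmin hy).trans_lt ?_
    simp only [hf]
    nlinarith [mul_nonneg hγ.le (sq_nonneg ‖y - x‖), mul_le_mul_of_nonneg_left hyr
      (mul_nonneg hγ.le hr.le)]
  have hwx : w ≠ x := by
    rintro rfl
    simp [hf] at hfw
  have hwr' : ‖w - x‖ < r := by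
    refine lt_of_le_of_ne hwr fun h => ?_
    simp only [hf, h] at hfw
    nlinarith [hm w hw, mul_pos hγ (mul_pos hr hr)]
  obtain ⟨φ, hφ, heq, -, hhess⟩ := exists_radial_test hwx (-(L + 2 * γ * r)) γ
  have hloc : IsLocalMinOn (fun q => u q - φ q) Ω w := by
    refine Filter.Eventually.filter_mono nhdsWithin_le_nhds ?_
    have hnhds : closedBall x r ∈ 𝓝 w :=
      mem_of_superset (isOpen_ball.mem_nhds (by simpa [dist_eq_norm] using hwr'))
        ball_subset_closedBall
    filter_upwards [heq, hnhds] with q hq hqr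
    have := hmin hqr
    simp only [hf, mem_ofPred_eq] at this
    rw [hq, heq.eq_of_nhds]
    linarith
  have h := (hu w (hsub hw) φ hφ hloc).2
  rw [hhess] at h
  have : 0 < -(-(L + 2 * γ * r) + 2 * γ * ‖w - x‖) := by nlinarith
  nlinarith [pow_pos this 2]

/-- A viscosity supersolution of `|∇u| ≥ c` drops by at least `c * r` in a ball of radius `r`. -/
theorem IsInftySuper.exists_le_sub {n : ℕ} {Ω : Set (EuclideanSpace ℝ (Fin n))} {Υ : ℝ}
    {u : EuclideanSpace ℝ (Fin n) → ℝ} (hu : IsInftySuper Ω Υ u) {x : EuclideanSpace ℝ (Fin n)}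
    {r c : ℝ} (hr : 0 < r) (hsub : closedBall x r ⊆ Ω) (hcont : ContinuousOn u (closedBall x r))
    (hc : 0 < c) (hcu : ∀ y ∈ closedBall x r, c ≤ Υ * Real.exp (u y)) :
    ∃ y ∈ closedBall x r, u y ≤ u x - c * r := by
  by_contra! hlt
  have hx : x ∈ closedBall x r := mem_closedBall_self hr.le
  obtain ⟨y, hy, hymin⟩ := (isCompact_closedBall x r).exists_isMinOn ⟨x, hx⟩ hcont
  obtain ⟨δ, hδ, hδc⟩ : ∃ δ > 0, c * δ < u y - (u x - c * r) := by
    have := hlt y hy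
    refine ⟨(u y - (u x - c * r)) / (2 * c), div_pos (by linarith) (by linarith), ?_⟩
    field_simp
    linarith
  set φ : EuclideanSpace ℝ (Fin n) → ℝ := fun q => -c * √(‖q - x‖ ^ 2 + δ ^ 2) with hφ
  have hφcd : ContDiff ℝ 2 φ := by
    refine contDiff_const.mul (ContDiff.sqrt ?_ fun q => by positivity)
    exact ((contDiff_id.sub contDiff_const).norm_sq ℝ).add contDiff_const
  obtain ⟨w, hw, hmin⟩ := (isCompact_closedBall x r).exists_isMinOn ⟨x, hx⟩
    (hcont.sub hφcd.continuous.continuousOn)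
  have hwr : ‖w - x‖ < r := by
    refine lt_of_le_of_ne (by simpa [dist_eq_norm] using hw) fun h => ?_
    have h1 : u w - φ w ≤ u x - φ x := hmin hx
    have h2 : u y ≤ u w := hymin hw
    have h3 : r ≤ √(‖w - x‖ ^ 2 + δ ^ 2) := Real.le_sqrt_of_sq_le (by rw [h]; nlinarith)
    have h4 : √(‖x - x‖ ^ 2 + δ ^ 2) = δ := by simp [Real.sqrt_sq hδ.le]
    simp only [hφ, h4] at h1
    nlinarith
  have hloc : IsLocalMinOn (fun q => u q - φ q) Ω w := by
    refine Filter.Eventually.filter_mono nhdsWithin_le_nhds ?_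
    have hnhds : closedBall x r ∈ 𝓝 w :=
      mem_of_superset (isOpen_ball.mem_nhds (by simpa [dist_eq_norm] using hwr))
        ball_subset_closedBall
    filter_upwards [hnhds] with q hqr using hmin hqr
  have hS : 0 < ‖w - x‖ ^ 2 + δ ^ 2 := by positivity
  have hgrad : gradient φ w = (-c / √(‖w - x‖ ^ 2 + δ ^ 2)) • (w - x) := by
    refine HasGradientAt.gradient (hasGradientAt_iff_hasFDerivAt.2 ?_)
    have h := (((((hasFDerivAt_id w).sub_const x).norm_sq).add_const (δ ^ 2)).sqrt
      (by simpa using hS.ne')).const_mul (-c)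
    refine h.congr_fderiv ?_
    have := Real.sqrt_pos.2 hS
    ext p
    simp
    field_simp
  have h := (hu w (hsub hw) φ hφcd hloc).1
  have hlt' : ‖w - x‖ < √(‖w - x‖ ^ 2 + δ ^ 2) := Real.lt_sqrt_of_sq_lt (by nlinarith)
  have hn : ‖gradient φ w‖ < c := by
    rw [hgrad, norm_smul, Real.norm_eq_abs, abs_div, abs_neg, abs_of_pos hc,
      abs_of_pos (Real.sqrt_pos.2 hS), div_mul_eq_mul_div, div_lt_iff₀ (Real.sqrt_pos.2 hS)]
    exact mul_lt_mul_of_pos_left hlt' hc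
  linarith [hcu w hw]

/-- Comparison with sufficiently steep cones from above for viscosity subsolutions. -/
theorem IsInftySub.le_cone {n : ℕ} {Ω : Set (EuclideanSpace ℝ (Fin n))} {Λ : ℝ}
    {v : EuclideanSpace ℝ (Fin n) → ℝ} (hv : IsInftySub Ω Λ v) {x : EuclideanSpace ℝ (Fin n)}
    {r L : ℝ} (hr : 0 < r) (hsub : closedBall x r ⊆ Ω) (hcont : ContinuousOn v (closedBall x r))
    (hL0 : 0 < L) (hL : ∀ y ∈ closedBall x r, Λ * Real.exp (v y) < L)
    (hM : ∀ y ∈ closedBall x r, v y ≤ v x + L * r) :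
    ∀ y ∈ closedBall x r, v y ≤ v x + L * ‖y - x‖ := by
  intro y hy
  by_contra! hlt
  have hx : x ∈ closedBall x r := mem_closedBall_self hr.le
  obtain ⟨γ, hγ, hγr⟩ : ∃ γ > 0, v x < v y - L * ‖y - x‖ - 2 * γ * r * r := by
    refine ⟨(v y - L * ‖y - x‖ - v x) / (4 * r * r), by apply div_pos <;> nlinarith, ?_⟩
    field_simp
    linarith
  set f : EuclideanSpace ℝ (Fin n) → ℝ :=
    fun q => v q - ((L + 2 * γ * r) * ‖q - x‖ + (-γ) * ‖q - x‖ ^ 2) with hf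
  have hfc : ContinuousOn f (closedBall x r) := hcont.sub (by fun_prop)
  obtain ⟨w, hw, hmax⟩ := (isCompact_closedBall x r).exists_isMaxOn ⟨x, hx⟩ hfc
  have hyr : ‖y - x‖ ≤ r := by simpa [dist_eq_norm] using hy
  have hwr : ‖w - x‖ ≤ r := by simpa [dist_eq_norm] using hw
  have hfw : v x < f w := by
    refine lt_of_lt_of_le ?_ (hmax hy)
    simp only [hf]
    nlinarith [mul_nonneg hγ.le (sq_nonneg ‖y - x‖), mul_le_mul_of_nonneg_left hyr
      (mul_nonneg hγ.le hr.le)]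
  have hwx : w ≠ x := by
    rintro rfl
    simp [hf] at hfw
  have hwr' : ‖w - x‖ < r := by
    refine lt_of_le_of_ne hwr fun h => ?_
    simp only [hf, h] at hfw
    nlinarith [hM w hw, mul_pos hγ (mul_pos hr hr)]
  obtain ⟨φ, hφ, heq, hgrad, hhess⟩ := exists_radial_test hwx (L + 2 * γ * r) (-γ)
  have hloc : IsLocalMaxOn (fun q => v q - φ q) Ω w := by
    refine Filter.Eventually.filter_mono nhdsWithin_le_nhds ?_
    have hnhds : closedBall x r ∈ 𝓝 w :=
      mem_of_superset (isOpen_ball.mem_nhds (by simpa [dist_eq_norm] using hwr'))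
        ball_subset_closedBall
    filter_upwards [heq, hnhds] with q hq hqr
    have := hmax hqr
    simp only [hf, mem_ofPred_eq] at this
    rw [hq, heq.eq_of_nhds]
    linarith
  have h := hv w (hsub hw) φ hφ hloc
  have hslope : L ≤ L + 2 * γ * r + 2 * -γ * ‖w - x‖ := by nlinarith
  rw [hhess, hgrad, abs_of_pos (hL0.trans_le hslope)] at h
  rcases min_le_iff.1 h with h | h
  · linarith [hL w hw]
  · nlinarith [pow_pos (hL0.trans_le hslope) 2]

/-- The sup-convolution of a continuous function over closed balls of a fixed radius. -/
theorem exists_max_over_closedBall {E : Type*} [NormedAddCommGroup E] [ProperSpace E] {f : E → ℝ}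
    (hf : Continuous f) {ε : ℝ} (hε : 0 < ε) :
    ∃ g : E → ℝ, Continuous g ∧ (∀ x, ∀ y ∈ closedBall x ε, f y ≤ g x) ∧
      ∀ x, ∃ y ∈ closedBall x ε, f y = g x := by
  have hK : IsCompact (closedBall (0 : E) ε) := isCompact_closedBall 0 ε
  have hfx : ∀ x, ContinuousOn (fun h => f (x + h)) (closedBall (0 : E) ε) := fun x => by fun_prop
  refine ⟨fun x => sSup ((fun h => f (x + h)) '' closedBall 0 ε),
    hK.continuous_sSup (f := fun x h => f (x + h)) (by fun_prop), fun x y hy => ?_, fun x => ?_⟩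
  · refine le_csSup (hK.image_of_continuousOn (hfx x)).bddAbove ⟨y - x, ?_, by simp⟩
    simpa [dist_eq_norm] using hy
  · obtain ⟨h, hh, heq⟩ := (hK.image_of_continuousOn (hfx x)).sSup_mem
      ((nonempty_closedBall.2 hε.le).image _)
    exact ⟨x + h, by simpa [dist_eq_norm] using hh, heq⟩

/-- The inf-convolution of a continuous function over closed balls of a fixed radius. -/
theorem exists_min_over_closedBall {E : Type*} [NormedAddCommGroup E] [ProperSpace E] {f : E → ℝ}
    (hf : Continuous f) {ε : ℝ} (hε : 0 < ε) :
    ∃ g : E → ℝ, Continuous g ∧ (∀ x, ∀ y ∈ closedBall x ε, g x ≤ f y) ∧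
      ∀ x, ∃ y ∈ closedBall x ε, f y = g x := by
  obtain ⟨g, hg, hle, hex⟩ := exists_max_over_closedBall hf.neg hε
  refine ⟨fun x => -g x, hg.neg, fun x y hy => neg_le.1 (hle x y hy), fun x => ?_⟩
  obtain ⟨y, hy, heq⟩ := hex x
  exact ⟨y, hy, by simp [← heq]⟩

theorem exists_mem_closedBall_of_two_mul {E : Type*} [NormedAddCommGroup E] [NormedSpace ℝ E]
    {x q : E} {ε : ℝ} (hq : q ∈ closedBall x (2 * ε)) :
    ∃ y ∈ closedBall x ε, q ∈ closedBall y ε := by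
  have h : ‖q - x‖ ≤ 2 * ε := by simpa [dist_eq_norm] using hq
  refine ⟨x + (2⁻¹ : ℝ) • (q - x), ?_, ?_⟩
  · simp only [mem_closedBall, dist_eq_norm, add_sub_cancel_left, norm_smul]
    norm_num
    linarith
  · have : q - (x + (2⁻¹ : ℝ) • (q - x)) = (2⁻¹ : ℝ) • (q - x) := by module
    rw [mem_closedBall, dist_eq_norm, this, norm_smul]
    norm_num
    linarith

/-- The discrete comparison argument of Armstrong and Smart at a single point. -/
theorem false_of_isMax_convolution {E : Type*} [NormedAddCommGroup E] [NormedSpace ℝ E]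
    [ProperSpace E] {v Z V W : E → ℝ} {x : E} {ε c C : ℝ} (hε : 0 < ε) (hcC : C < c) (hC : 0 < C)
    (hVc : Continuous V) (hWc : Continuous W)
    (hV : ∀ x, ∀ y ∈ closedBall x ε, v y ≤ V x) (hV' : ∀ x, ∃ y ∈ closedBall x ε, v y = V x)
    (hW : ∀ x, ∀ y ∈ closedBall x ε, W x ≤ Z y) (hW' : ∀ x, ∃ y ∈ closedBall x ε, Z y = W x)
    (hsuper : ∀ m, (∀ y ∈ closedBall x (2 * ε), m ≤ Z y) →
      ∀ y ∈ closedBall x (2 * ε), Z x - (Z x - m) / (2 * ε) * ‖y - x‖ ≤ Z y)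
    (hslope : ∀ z ∈ closedBall x ε, ∃ y ∈ closedBall z ε, Z y ≤ Z z - c * ε)
    (hsub : ∀ L, C ≤ L → (∀ y ∈ closedBall x (2 * ε), v y ≤ v x + L * (2 * ε)) →
      ∀ y ∈ closedBall x (2 * ε), v y ≤ v x + L * ‖y - x‖)
    (hmax : ∀ y ∈ closedBall x ε, V y - W y ≤ V x - W x)
    (hVmax : ∀ y ∈ closedBall x ε, V y - W y = V x - W x → V y ≤ V x) : False := by
  have hx : x ∈ closedBall x ε := mem_closedBall_self hε.le
  have hsubset : closedBall x ε ⊆ closedBall x (2 * ε) := closedBall_subset_closedBall (by linarith)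
  obtain ⟨y₁, hy₁, hy₁max⟩ := (isCompact_closedBall x ε).exists_isMaxOn ⟨x, hx⟩ hVc.continuousOn
  obtain ⟨z₁, hz₁, hz₁min⟩ := (isCompact_closedBall x ε).exists_isMinOn ⟨x, hx⟩ hWc.continuousOn
  have hM : ∀ q ∈ closedBall x (2 * ε), v q ≤ V y₁ := fun q hq => by
    obtain ⟨y, hy, hqy⟩ := exists_mem_closedBall_of_two_mul hq
    exact (hV y q hqy).trans (hy₁max hy)
  have hm : ∀ q ∈ closedBall x (2 * ε), W z₁ ≤ Z q := fun q hq => by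
    obtain ⟨y, hy, hqy⟩ := exists_mem_closedBall_of_two_mul hq
    exact (hz₁min hy).trans (hW y q hqy)
  obtain ⟨ζ, hζ, hζW⟩ := hW' x
  obtain ⟨ξ, hξ, hξV⟩ := hV' x
  have hdrop : W z₁ ≤ W x - c * ε := by
    obtain ⟨y, hy, hyle⟩ := hslope ζ hζ
    rw [← hζW]
    refine (hm y ?_).trans hyle
    rw [mem_closedBall] at *
    linarith [dist_triangle y ζ x]
  have hS1 : Z x + W z₁ ≤ 2 * W x := by
    have h := hsuper _ hm ζ (hsubset hζ)
    have hn : ‖ζ - x‖ ≤ ε := by simpa [dist_eq_norm] using hζ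
    have h2 : (Z x - W z₁) / (2 * ε) * ‖ζ - x‖ ≤ (Z x - W z₁) / (2 * ε) * ε :=
      mul_le_mul_of_nonneg_left hn
        (div_nonneg (by linarith [hm x (hsubset hx)]) (by linarith))
    have h3 : (Z x - W z₁) / (2 * ε) * ε = (Z x - W z₁) / 2 := by field_simp
    linarith
  have hvz : v x ≤ V z₁ := hV z₁ x (by rwa [mem_closedBall, dist_comm])
  have hgap : c * ε ≤ V x - v x := by linarith [hmax z₁ hz₁]
  have hsubL : ∀ L, C ≤ L → V y₁ ≤ v x + L * (2 * ε) → V x ≤ v x + L * ε := fun L hL hLM => by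
    have h := hsub L hL (fun y hy => (hM y hy).trans hLM) ξ (hsubset hξ)
    have hn : ‖ξ - x‖ ≤ ε := by simpa [dist_eq_norm] using hξ
    nlinarith
  have hS2 : 2 * V x ≤ v x + V y₁ := by
    rcases le_total C ((V y₁ - v x) / (2 * ε)) with h | h
    · have h1 := hsubL _ h (le_of_eq (by field_simp; ring))
      have h3 : (V y₁ - v x) / (2 * ε) * ε = (V y₁ - v x) / 2 := by field_simp
      linarith
    · rw [div_le_iff₀ (by linarith)] at h
      have := hsubL C le_rfl (by linarith)
      nlinarith
  have hWy : W y₁ ≤ Z x := hW y₁ x (by rwa [mem_closedBall, dist_comm])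
  have h1 := hmax y₁ hy₁
  have h2 := hmax z₁ hz₁
  have h3 := hVmax y₁ hy₁ (by linarith)
  nlinarith

theorem IsInftySuper.congr {n : ℕ} {Ω : Set (EuclideanSpace ℝ (Fin n))} {Υ : ℝ}
    {u u' : EuclideanSpace ℝ (Fin n) → ℝ} (hu : IsInftySuper Ω Υ u) (h : EqOn u' u Ω) :
    IsInftySuper Ω Υ u' := by
  intro x hx φ hφ hloc
  rw [h hx]
  refine hu x hx φ hφ ?_
  filter_upwards [hloc, self_mem_nhdsWithin] with y hy hyΩ
  simpa only [h hx, h hyΩ] using hy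

theorem IsInftySub.congr {n : ℕ} {Ω : Set (EuclideanSpace ℝ (Fin n))} {Λ : ℝ}
    {v v' : EuclideanSpace ℝ (Fin n) → ℝ} (hv : IsInftySub Ω Λ v) (h : EqOn v' v Ω) :
    IsInftySub Ω Λ v' := by
  intro x hx φ hφ hloc
  rw [h hx]
  refine hv x hx φ hφ ?_
  filter_upwards [hloc, self_mem_nhdsWithin] with y hy hyΩ
  simpa only [h hx, h hyΩ] using hy

theorem ContinuousOn.exists_continuous_eqOn {X : Type*} [TopologicalSpace X] [NormalSpace X]
    {s : Set X} (hs : IsClosed s) {f : X → ℝ} (hf : ContinuousOn f s) :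
    ∃ g : X → ℝ, Continuous g ∧ EqOn g f s := by
  obtain ⟨g, hg⟩ := ContinuousMap.exists_restrict_eq hs ⟨s.domRestrict f, hf.domRestrict⟩
  exact ⟨g, g.continuous, fun x hx => DFunLike.congr_fun hg ⟨x, hx⟩⟩

/-- A subsolution cannot touch from below, inside the domain, a multiple of a shifted
supersolution which is strictly steeper at the contact points. -/
theorem false_of_touching {n : ℕ} {Ω : Set (EuclideanSpace ℝ (Fin n))} (hΩo : IsOpen Ω)
    (hΩb : Bornology.IsBounded Ω) {Λ Υ t η : ℝ} (hΛ : 0 < Λ) (ht : 0 < t)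
    {v w : EuclideanSpace ℝ (Fin n) → ℝ} (hvc : Continuous v) (hwc : Continuous w)
    (hv : IsInftySub Ω Λ v) (hw : IsInftySuper Ω Υ w)
    (hfr : ∀ x ∈ frontier Ω, v x < t * (w x + η)) {x₀ : EuclideanSpace ℝ (Fin n)}
    (hx₀ : x₀ ∈ closure Ω) (hcontact : v x₀ = t * (w x₀ + η))
    (hle : ∀ x ∈ closure Ω, v x ≤ t * (w x + η))
    (hsteep : ∀ x ∈ Ω, v x = t * (w x + η) → Λ * Real.exp (v x) < t * (Υ * Real.exp (w x))) :
    False := by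
  set Z : EuclideanSpace ℝ (Fin n) → ℝ := fun x => t * (w x + η) with hZ
  have hZc : Continuous Z := by fun_prop
  have hK : IsCompact (closure Ω) := hΩb.isCompact_closure
  have key : ∀ ε : ℝ, 0 < ε → ∃ (V W : EuclideanSpace ℝ (Fin n) → ℝ), ∃ x ∈ closure Ω,
      Continuous V ∧ Continuous W ∧
      (∀ x, ∀ y ∈ closedBall x ε, v y ≤ V x) ∧ (∀ x, ∃ y ∈ closedBall x ε, v y = V x) ∧
      (∀ x, ∀ y ∈ closedBall x ε, W x ≤ Z y) ∧ (∀ x, ∃ y ∈ closedBall x ε, Z y = W x) ∧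
      (∀ y ∈ closure Ω, V y - W y ≤ V x - W x) ∧
      (∀ y ∈ closure Ω, V y - W y = V x - W x → V y ≤ V x) := by
    intro ε hε
    obtain ⟨V, hVc, hV, hV'⟩ := exists_max_over_closedBall hvc hε
    obtain ⟨W, hWc, hW, hW'⟩ := exists_min_over_closedBall hZc hε
    obtain ⟨p, hp, hpmax⟩ := hK.exists_isMaxOn ⟨x₀, hx₀⟩ (hVc.sub hWc).continuousOn
    have hF : IsCompact (closure Ω ∩ {y | V y - W y = V p - W p}) :=
      hK.inter_right (isClosed_eq (hVc.sub hWc) continuous_const)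
    obtain ⟨x, hx, hxmax⟩ := hF.exists_isMaxOn ⟨p, hp, rfl⟩ hVc.continuousOn
    have hxp : V x - W x = V p - W p := hx.2
    refine ⟨V, W, x, hx.1, hVc, hWc, hV, hV', hW, hW', fun y hy => ?_, fun y hy hyx => ?_⟩
    · rw [hxp]
      exact hpmax hy
    · exact hxmax ⟨hy, hyx.trans hxp⟩
  choose! V W x hx hVc hWc hV hV' hW hW' hmax hVmax using key
  let ε : ℕ → ℝ := fun k => 1 / ((k : ℝ) + 1)
  have hε : ∀ k, 0 < ε k := fun k => Nat.one_div_pos_of_nat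
  have hε0 : Tendsto ε atTop (𝓝 0) := tendsto_one_div_add_atTop_nhds_zero_nat
  obtain ⟨a, ha, θ, hθ, hlim⟩ := hK.tendsto_subseq fun k => hx (ε k) (hε k)
  have hεθ : Tendsto (ε ∘ θ) atTop (𝓝 0) := hε0.comp hθ.tendsto_atTop
  have haZ : Z a ≤ v a := by
    have hp : ∀ k, ∃ p ∈ closedBall (x (ε k)) (ε k), ∃ q ∈ closedBall (x (ε k)) (ε k),
        Z q ≤ v p := fun k => by
      obtain ⟨p, hp, hpV⟩ := hV' _ (hε k) (x (ε k))
      obtain ⟨q, hq, hqW⟩ := hW' _ (hε k) (x (ε k))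
      refine ⟨p, hp, q, hq, ?_⟩
      have h1 := hmax _ (hε k) x₀ hx₀
      have h2 := hV _ (hε k) x₀ x₀ (mem_closedBall_self (hε k).le)
      have h3 := hW _ (hε k) x₀ x₀ (mem_closedBall_self (hε k).le)
      have h4 : Z x₀ = v x₀ := hcontact.symm
      linarith
    choose p hp q hq hqp using hp
    have hto : ∀ p : ℕ → EuclideanSpace ℝ (Fin n),
        (∀ k, p k ∈ closedBall (x (ε k)) (ε k)) → Tendsto (p ∘ θ) atTop (𝓝 a) := fun p hp => by
      have h0 : Tendsto (fun k => dist (x (ε (θ k))) (p (θ k))) atTop (𝓝 0) :=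
        squeeze_zero (fun _ => dist_nonneg) (fun k => by
          rw [dist_comm]; exact mem_closedBall.1 (hp (θ k))) hεθ
      exact (tendsto_iff_of_dist h0).1 hlim
    exact le_of_tendsto_of_tendsto' ((hZc.tendsto a).comp (hto q hq))
      ((hvc.tendsto a).comp (hto p hp)) fun k => hqp (θ k)
  have haΩ : a ∈ Ω := by
    by_contra h
    exact absurd (hfr a (hΩo.frontier_eq ▸ ⟨ha, h⟩)) (not_lt.2 haZ)
  obtain ⟨C, hC, hC'⟩ := exists_between (hsteep a haΩ (le_antisymm (hle a ha) haZ))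
  obtain ⟨c, hCc, hc⟩ := exists_between hC'
  have hC0 : 0 < C := (mul_pos hΛ (Real.exp_pos _)).trans hC
  have hnear : ∀ᶠ y in 𝓝 a, y ∈ Ω ∧ Λ * Real.exp (v y) < C ∧ c < t * (Υ * Real.exp (w y)) := by
    refine Filter.Eventually.and (hΩo.mem_nhds haΩ) (Filter.Eventually.and ?_ ?_)
    · exact (by fun_prop : Continuous fun y => Λ * Real.exp (v y)).continuousAt.eventually
        (gt_mem_nhds hC)
    · exact (by fun_prop : Continuous fun y => t * (Υ * Real.exp (w y))).continuousAt.eventually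
        (lt_mem_nhds hc)
  obtain ⟨ρ, hρ, hball⟩ := Metric.eventually_nhds_iff.1 hnear
  obtain ⟨k, hk1, hk2⟩ := ((hlim.eventually (ball_mem_nhds a (half_pos hρ))).and
    (hεθ.eventually (gt_mem_nhds (show 0 < ρ / 4 by linarith)))).exists
  simp only [Function.comp_apply] at hk1 hk2
  set e := ε (θ k)
  have he : 0 < e := hε _
  have hsubset : ∀ y ∈ closedBall (x e) (2 * e), dist y a < ρ := fun y hy => by
    rw [mem_closedBall] at hy
    have : dist (x e) a < ρ / 2 := hk1
    linarith [dist_triangle y (x e) a]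
  have hsubset1 : closedBall (x e) e ⊆ closedBall (x e) (2 * e) :=
    closedBall_subset_closedBall (by linarith)
  have hsubΩ : closedBall (x e) (2 * e) ⊆ Ω := fun y hy => (hball (hsubset y hy)).1
  have he2 : 0 < 2 * e := by linarith
  refine false_of_isMax_convolution he hCc hC0 (hVc e he) (hWc e he) (hV e he) (hV' e he)
    (hW e he) (hW' e he) (fun m hm y hy => ?_) (fun z hz => ?_) (fun L hL hLr => ?_)
    (fun y hy => hmax e he y (subset_closure (hsubΩ (hsubset1 hy))))
    (fun y hy => hVmax e he y (subset_closure (hsubΩ (hsubset1 hy))))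
  · have h := hw.cone_le_s10 he2 hsubΩ hwc.continuousOn (m := m / t - η) (fun q hq => by
      have := hm q hq
      rw [sub_le_iff_le_add, div_le_iff₀ ht]
      simp only [hZ] at this
      linarith) y hy
    have h' := mul_le_mul_of_nonneg_left h ht.le
    have hrew : (Z (x e) - m) / (2 * e) = t * ((w (x e) - (m / t - η)) / (2 * e)) := by
      simp only [hZ]
      field_simp
      ring
    rw [hrew]
    simp only [hZ]
    linarith
  · have hzsub : closedBall z e ⊆ closedBall (x e) (2 * e) := fun y hy => by
      rw [mem_closedBall] at *
      linarith [dist_triangle y z (x e)]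
    obtain ⟨y, hy, hyle⟩ := hw.exists_le_sub he (hzsub.trans hsubΩ) hwc.continuousOn (c := c / t)
      (div_pos (hC0.trans hCc) ht) (fun q hq => by
        rw [div_le_iff₀ ht]
        linarith [(hball (hsubset q (hzsub hq))).2.2])
    refine ⟨y, hy, ?_⟩
    have h' := mul_le_mul_of_nonneg_left hyle ht.le
    have hrew : t * (w z - c / t * e) = t * w z - c * e := by field_simp
    simp only [hZ]
    linarith
  · exact hv.le_cone he2 hsubΩ hvc.continuousOn (hC0.trans_le hL)
      (fun y hy => (hball (hsubset y hy)).2.1.trans_le hL) hLr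

theorem exp_le_mul_exp_div {t s : ℝ} (ht : 1 ≤ t) (hs : s ≤ 1) :
    Real.exp s ≤ t * Real.exp (s / t) := by
  have ht0 : 0 < t := by linarith
  have hlog : 1 - t⁻¹ ≤ Real.log t := Real.one_sub_inv_le_log_of_pos ht0
  have hinv : t⁻¹ ≤ 1 := inv_le_one_of_one_le₀ ht
  calc Real.exp s ≤ Real.exp (Real.log t + s / t) := by
        rw [Real.exp_le_exp, div_eq_mul_inv]
        nlinarith
    _ = t * Real.exp (s / t) := by rw [Real.exp_add, Real.exp_log ht0]

/-- Viscosity supersolutions with positive parameter are nonnegative if they are so on the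
boundary. -/
theorem IsInftySuper.nonneg {n : ℕ} {Ω : Set (EuclideanSpace ℝ (Fin n))} (hΩo : IsOpen Ω)
    (hΩb : Bornology.IsBounded Ω) {Υ : ℝ} (hΥ : 0 < Υ) {w : EuclideanSpace ℝ (Fin n) → ℝ}
    (hw : IsInftySuper Ω Υ w) (hwc : ContinuousOn w (closure Ω))
    (hbdry : ∀ x ∈ frontier Ω, 0 ≤ w x) : ∀ x ∈ closure Ω, 0 ≤ w x := by
  intro x hx
  obtain ⟨p, hp, hpmin⟩ := hΩb.isCompact_closure.exists_isMinOn ⟨x, hx⟩ hwc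
  refine (hbdry p (hΩo.frontier_eq ▸ ⟨hp, fun hpΩ => ?_⟩)).trans (hpmin hx)
  have h := (hw p hpΩ (fun _ => 0) contDiff_const ?_).1
  · rw [gradient_fun_const, norm_zero] at h
    linarith [mul_pos hΥ (Real.exp_pos (w p))]
  · filter_upwards [self_mem_nhdsWithin] with y hy
    simpa using hpmin (subset_closure hy)

/-- Monotonicity of small solutions: if `0 < Λ < Υ < Λ_max` and
`u_Λ, u_Υ` are solutions at parameters `Λ, Υ` with sup-norm below `1`, then
`u_Λ ≤ u_Υ`. -/
theorem monotonicity_small_solutions {n : ℕ} (Ω : Set (EuclideanSpace ℝ (Fin n)))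
    (hΩo : IsOpen Ω) (hΩb : Bornology.IsBounded Ω)
    (RΩ : ℝ) (hR : RΩ = sSup ((fun x => infDist x (frontier Ω)) '' Ω))
    (Λ Υ : ℝ) (hΛ : 0 < Λ) (hΛΥ : Λ < Υ) (hΥ : Υ < 1 / (Real.exp 1 * RΩ))
    (uΛ uΥ : EuclideanSpace ℝ (Fin n) → ℝ)
    (huΛ_cont : ContinuousOn uΛ (closure Ω)) (huΥ_cont : ContinuousOn uΥ (closure Ω))
    (huΛ_sol : IsInftySol Ω Λ uΛ) (huΥ_sol : IsInftySol Ω Υ uΥ)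
    (huΛ_bdry : ∀ x ∈ frontier Ω, uΛ x = 0) (huΥ_bdry : ∀ x ∈ frontier Ω, uΥ x = 0)
    (huΛ_small : sSup ((fun x => |uΛ x|) '' closure Ω) < 1)
    (huΥ_small : sSup ((fun x => |uΥ x|) '' closure Ω) < 1) :
    ∀ x ∈ closure Ω, uΛ x ≤ uΥ x := by
  have hK : IsCompact (closure Ω) := hΩb.isCompact_closure
  have hΥ0 : 0 < Υ := hΛ.trans hΛΥ
  obtain ⟨v, hvc, hvu⟩ := huΛ_cont.exists_continuous_eqOn isClosed_closure
  obtain ⟨w, hwc, hwu⟩ := huΥ_cont.exists_continuous_eqOn isClosed_closure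
  have hv : IsInftySub Ω Λ v := huΛ_sol.2.congr (hvu.mono subset_closure)
  have hw : IsInftySuper Ω Υ w := huΥ_sol.1.congr (hwu.mono subset_closure)
  have hv0 : ∀ x ∈ frontier Ω, v x = 0 := fun x hx => by
    rw [hvu (frontier_subset_closure hx), huΛ_bdry x hx]
  have hw0 : ∀ x ∈ closure Ω, 0 ≤ w x := hw.nonneg hΩo hΩb hΥ0 hwc.continuousOn fun x hx => by
    rw [hwu (frontier_subset_closure hx), huΥ_bdry x hx]
  have hv1 : ∀ x ∈ closure Ω, v x ≤ 1 := fun x hx => by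
    rw [hvu hx]
    exact ((le_abs_self _).trans (le_csSup (hK.image_of_continuousOn huΛ_cont.abs).bddAbove
      (mem_image_of_mem _ hx))).trans huΛ_small.le
  intro x₁ hx₁
  rw [← hvu hx₁, ← hwu hx₁]
  by_contra! hlt
  obtain ⟨η, ⟨hηlt, hηexp⟩, hη⟩ : ∃ η, (η < v x₁ - w x₁ ∧ Λ < Υ * Real.exp (-η)) ∧ 0 < η := by
    have h1 : ∀ᶠ η in 𝓝 (0 : ℝ), η < v x₁ - w x₁ := gt_mem_nhds (sub_pos.2 hlt)
    have h2 : ∀ᶠ η in 𝓝 (0 : ℝ), Λ < Υ * Real.exp (-η) :=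
      (by fun_prop : Continuous fun η : ℝ => Υ * Real.exp (-η)).continuousAt.eventually
        (lt_mem_nhds (by simpa using hΛΥ))
    exact (((h1.and h2).filter_mono nhdsWithin_le_nhds).and
      (self_mem_nhdsWithin (s := Ioi (0 : ℝ)))).exists
  have hpos : ∀ x ∈ closure Ω, 0 < w x + η := fun x hx => by linarith [hw0 x hx]
  obtain ⟨x₀, hx₀, hmax⟩ := hK.exists_isMaxOn ⟨x₁, hx₁⟩
    (hvc.continuousOn.div (hwc.continuousOn.add continuousOn_const) fun x hx => (hpos x hx).ne')
  set t := v x₀ / (w x₀ + η) with ht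
  have ht1 : 1 < t := ((one_lt_div (hpos x₁ hx₁)).2 (by linarith)).trans_le (hmax hx₁)
  have ht0 : 0 < t := by linarith
  refine false_of_touching hΩo hΩb hΛ ht0 hvc hwc hv hw (η := η) (fun x hx => ?_) hx₀
    (div_mul_cancel₀ _ (hpos x₀ hx₀).ne').symm
    (fun x hx => (div_le_iff₀ (hpos x hx)).1 (hmax hx)) (fun x hx hxt => ?_)
  · rw [hv0 x hx]
    exact mul_pos ht0 (hpos x (frontier_subset_closure hx))
  · have hxc := subset_closure hx
    have hdiv : w x = -η + v x / t := by
      rw [hxt]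
      field_simp
      ring
    calc Λ * Real.exp (v x) < Υ * Real.exp (-η) * Real.exp (v x) :=
          mul_lt_mul_of_pos_right hηexp (Real.exp_pos _)
      _ ≤ Υ * Real.exp (-η) * (t * Real.exp (v x / t)) :=
          mul_le_mul_of_nonneg_left (exp_le_mul_exp_div ht1.le (hv1 x hxc)) (by positivity)
      _ = t * (Υ * Real.exp (w x)) := by
          rw [hdiv, Real.exp_add]
          ring
end
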